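/- arXiv:2110.15205 — 2 statements merged into one kernel-verified Lean document; each statement's English description precedes it below -/
import Mathlib

section
/- There exists an absolute constant C such that for all positive integers m, n, the identity map on ℝ^{m×n}, viewed as a map from (ℝ^{m×n}, ‖·‖_∧) to (ℝ^{m×n}, ‖·‖_∨), satisfies E_{2,1}(id) := Σ_{k≥1} e_k(id)/√k ≤ C √(1 + m + n) · (1 + ln m + ln n)^{3/2}, where ‖M‖_∧ := inf{Σ_i ‖x_i‖_∞ ‖y_i‖_∞ : M = Σ_i x_i y_iᵀ, x_i ∈ ℝ^m, y_i ∈ ℝ^n} is the projective tensor norm on ℓ∞^m ⊗ ℓ∞^n and ‖M‖_∨ := max_{k,l} |M_{kl}| is the injective tensor norm. -/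
open Real Set Matrix
open scoped Pointwise

/-- Packing number `M(D,E)`. -/
noncomputable def packingNumber {V : Type*} [AddGroup V] (D E : Set V) : ℕ∞ :=
  sSup {l : ℕ∞ | ∃ (l' : ℕ) (y : Fin l' → V), l = (l' : ℕ∞) ∧ (∀ i, y i ∈ D) ∧
    ∀ i j, i ≠ j → y i - y j ∉ E}

/-- Dyadic entropy numbers of the identity, between the norms with unit balls `D` and `E`:
`e_k = inf {ε > 0 : M(D, ε E) ≤ 2^{k−1}}`. -/
noncomputable def entropyNumberBalls {V : Type*} [AddCommGroup V] [Module ℝ V]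
    (D E : Set V) (k : ℕ) : ℝ :=
  sInf {ε : ℝ | 0 < ε ∧ packingNumber D (ε • E) ≤ (2^(k-1) : ℕ∞)}

/-- `E_{2,1} = Σ_{k ≥ 1} e_k/√k` -/
noncomputable def E21balls {V : Type*} [AddCommGroup V] [Module ℝ V] (D E : Set V) : ℝ :=
  ∑' k : ℕ, entropyNumberBalls D E (k+1) / Real.sqrt (k+1)

/-- sup-norm of a vector -/
noncomputable def supNorm {n : ℕ} (x : Fin n → ℝ) : ℝ := ⨆ j, |x j|

/-- projective tensor norm on `ℓ∞^m ⊗ ℓ∞^n`: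
`‖M‖_∧ = inf {Σ_i ‖x_i‖_∞ ‖y_i‖_∞ : M = Σ_i x_i y_iᵀ}` -/
noncomputable def projNormInfInf {m n : ℕ} (M : Matrix (Fin m) (Fin n) ℝ) : ℝ :=
  sInf {c | ∃ (s : ℕ) (x : Fin s → (Fin m → ℝ)) (y : Fin s → (Fin n → ℝ)),
    (∀ a b, M a b = ∑ i, x i a * y i b) ∧ c = ∑ i, supNorm (x i) * supNorm (y i)}

/-- injective tensor norm on `ℓ∞^m ⊗ ℓ∞^n`: the largest entry magnitude -/
noncomputable def injNormInfInf {m n : ℕ} (M : Matrix (Fin m) (Fin n) ℝ) : ℝ :=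
  ⨆ i, ⨆ j, |M i j|

/-- The sign `±1` encoded by a Boolean. -/
def boolSign (b : Bool) : ℝ := if b then 1 else -1

lemma abs_boolSign (b : Bool) : |boolSign b| = 1 := by
  cases b <;> simp [boolSign]

/-- The rank-one sign matrix `ε ηᵀ`. -/
def signMatrix {m n : ℕ} (p : (Fin m → Bool) × (Fin n → Bool)) : Matrix (Fin m) (Fin n) ℝ :=
  fun a b => boolSign (p.1 a) * boolSign (p.2 b)

lemma abs_signMatrix {m n : ℕ} (p : (Fin m → Bool) × (Fin n → Bool)) (a : Fin m) (b : Fin n) :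
    |signMatrix p a b| = 1 := by
  simp [signMatrix, abs_mul, abs_boolSign]

lemma abs_le_supNorm {n : ℕ} (x : Fin n → ℝ) (j : Fin n) : |x j| ≤ supNorm x :=
  le_ciSup (f := fun j => |x j|) (Set.finite_range _).bddAbove j

lemma supNorm_nonneg {n : ℕ} (x : Fin n → ℝ) : 0 ≤ supNorm x :=
  Real.iSup_nonneg fun _ => abs_nonneg _

/-- A linear functional on `ℓ∞` is maximised, up to the norm, at a sign vector. -/
lemma exists_sign_sum_mul_le {n : ℕ} (c : Fin n → ℝ) :
    ∃ ε : Fin n → Bool, ∀ x : Fin n → ℝ,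
      ∑ j, c j * x j ≤ supNorm x * ∑ j, c j * boolSign (ε j) := by
  refine ⟨fun j => decide (0 ≤ c j), fun x => ?_⟩
  rw [Finset.mul_sum]
  refine Finset.sum_le_sum fun j _ => ?_
  have hsign : c j * boolSign (decide (0 ≤ c j)) = |c j| := by
    by_cases h : 0 ≤ c j
    · simp [boolSign, h, abs_of_nonneg h]
    · simp [boolSign, h, abs_of_neg (not_le.1 h)]
  rw [hsign]
  calc c j * x j ≤ |c j * x j| := le_abs_self _
    _ = |x j| * |c j| := by rw [abs_mul, mul_comm]
    _ ≤ supNorm x * |c j| := by gcongr; exact abs_le_supNorm x j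

lemma exists_signMatrix_bilin_le {m n : ℕ} (h : Matrix (Fin m) (Fin n) ℝ)
    (x : Fin m → ℝ) (y : Fin n → ℝ) :
    ∃ p, ∑ a, ∑ b, h a b * (x a * y b) ≤
      supNorm x * supNorm y * ∑ a, ∑ b, h a b * signMatrix p a b := by
  obtain ⟨ε, hε⟩ := exists_sign_sum_mul_le fun a => ∑ b, h a b * y b
  obtain ⟨η, hη⟩ := exists_sign_sum_mul_le fun b => ∑ a, h a b * boolSign (ε a)
  refine ⟨(ε, η), ?_⟩
  calc ∑ a, ∑ b, h a b * (x a * y b) = ∑ a, (∑ b, h a b * y b) * x a := by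
        refine Finset.sum_congr rfl fun a _ => ?_
        rw [Finset.sum_mul]
        exact Finset.sum_congr rfl fun b _ => by ring
    _ ≤ supNorm x * ∑ a, (∑ b, h a b * y b) * boolSign (ε a) := hε x
    _ = supNorm x * ∑ b, (∑ a, h a b * boolSign (ε a)) * y b := by
        simp only [Finset.sum_mul]
        rw [Finset.sum_comm]
        congr 1
        exact Finset.sum_congr rfl fun b _ => Finset.sum_congr rfl fun a _ => by ring
    _ ≤ supNorm x * (supNorm y * ∑ b, (∑ a, h a b * boolSign (ε a)) * boolSign (η b)) :=
        mul_le_mul_of_nonneg_left (hη y) (supNorm_nonneg x)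
    _ = supNorm x * supNorm y * ∑ a, ∑ b, h a b * signMatrix (ε, η) a b := by
        simp only [Finset.sum_mul]
        rw [Finset.sum_comm, mul_assoc]
        congr 2
        exact Finset.sum_congr rfl fun b _ => Finset.sum_congr rfl fun a _ => by
          simp only [signMatrix]; ring

lemma projNormInfInf_set_nonempty {m n : ℕ} (M : Matrix (Fin m) (Fin n) ℝ) :
    {c | ∃ (s : ℕ) (x : Fin s → (Fin m → ℝ)) (y : Fin s → (Fin n → ℝ)),
      (∀ a b, M a b = ∑ i, x i a * y i b) ∧
        c = ∑ i, supNorm (x i) * supNorm (y i)}.Nonempty :=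
  ⟨_, m, fun i => Pi.single i 1, fun i => M i, fun a b => by simp [Pi.single_apply], rfl⟩

/-- Every linear functional on the unit ball of the projective norm is dominated by its value
at some rank-one sign matrix. -/
lemma exists_signMatrix_le {m n : ℕ} {M : Matrix (Fin m) (Fin n) ℝ}
    (hM : projNormInfInf M ≤ 1) (h : Matrix (Fin m) (Fin n) ℝ) :
    ∃ p, ∑ a, ∑ b, h a b * M a b ≤ ∑ a, ∑ b, h a b * signMatrix p a b := by
  obtain ⟨q, hq⟩ := Finite.exists_max fun p : (Fin m → Bool) × (Fin n → Bool) =>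
    ∑ a, ∑ b, h a b * signMatrix p a b
  refine ⟨q, ?_⟩
  set K := ∑ a, ∑ b, h a b * signMatrix q a b with hK
  have hK0 : 0 ≤ K := by
    have h2 := hq (fun a => !q.1 a, q.2)
    have h3 : ∑ a, ∑ b, h a b * signMatrix (fun a => !q.1 a, q.2) a b = -K := by
      rw [hK, ← Finset.sum_neg_distrib]
      refine Finset.sum_congr rfl fun a _ => ?_
      rw [← Finset.sum_neg_distrib]
      refine Finset.sum_congr rfl fun b _ => ?_
      cases h1 : q.1 a <;> cases h2 : q.2 b <;> simp [signMatrix, boolSign, h1, h2]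
    have h4 : -K ≤ K := h3 ▸ h2
    linarith
  have key : ∀ c ∈ {c | ∃ (s : ℕ) (x : Fin s → (Fin m → ℝ)) (y : Fin s → (Fin n → ℝ)),
      (∀ a b, M a b = ∑ i, x i a * y i b) ∧ c = ∑ i, supNorm (x i) * supNorm (y i)},
      ∑ a, ∑ b, h a b * M a b ≤ c * K := by
    rintro c ⟨s, x, y, hxy, rfl⟩
    calc ∑ a, ∑ b, h a b * M a b = ∑ i, ∑ a, ∑ b, h a b * (x i a * y i b) := by
          simp only [hxy, Finset.mul_sum]
          rw [Finset.sum_comm]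
          simp only [Finset.sum_comm (s := (Finset.univ : Finset (Fin s)))]
          rw [Finset.sum_comm]
      _ ≤ ∑ i, supNorm (x i) * supNorm (y i) * K := by
          refine Finset.sum_le_sum fun i _ => ?_
          obtain ⟨p, hp⟩ := exists_signMatrix_bilin_le h (x i) (y i)
          refine hp.trans (mul_le_mul_of_nonneg_left (hq p) ?_)
          exact mul_nonneg (supNorm_nonneg _) (supNorm_nonneg _)
      _ = (∑ i, supNorm (x i) * supNorm (y i)) * K := by rw [Finset.sum_mul]
  refine le_of_forall_pos_le_add fun δ hδ => ?_
  obtain ⟨c, hc, hcl⟩ := exists_lt_of_csInf_lt (projNormInfInf_set_nonempty M)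
    (show projNormInfInf M < 1 + δ / (K + 1) from
      hM.trans_lt (lt_add_of_pos_right _ (by positivity)))
  calc _ ≤ c * K := key c hc
    _ ≤ (1 + δ / (K + 1)) * K := by gcongr
    _ = K + δ * (K / (K + 1)) := by ring
    _ ≤ K + δ * 1 := by
        gcongr
        rw [div_le_one (by positivity)]; linarith
    _ = K + δ := by ring

lemma abs_le_one_of_projNormInfInf_le {m n : ℕ} {M : Matrix (Fin m) (Fin n) ℝ}
    (hM : projNormInfInf M ≤ 1) (a : Fin m) (b : Fin n) : |M a b| ≤ 1 := by
  have eval (r : ℝ) (N : Matrix (Fin m) (Fin n) ℝ) :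
      ∑ a', ∑ b', (Matrix.single a b r) a' b' * N a' b' = r * N a b := by
    rw [Finset.sum_eq_single a, Finset.sum_eq_single b]
    · simp
    · intro b' _ hb; simp [hb.symm]
    · simp
    · intro a' _ ha; simp [ha.symm]
    · simp
  obtain ⟨p, hp⟩ := exists_signMatrix_le hM (Matrix.single a b 1)
  obtain ⟨q, hq⟩ := exists_signMatrix_le hM (Matrix.single a b (-1))
  rw [eval, eval] at hp hq
  have h1 := abs_le.1 (abs_signMatrix p a b).le
  have h2 := abs_le.1 (abs_signMatrix q a b).le
  exact abs_le.2 ⟨by linarith, by linarith⟩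

lemma exp_le_one_add_add_four_mul_sq {l x : ℝ} (hl0 : 0 ≤ l) (hl : l ≤ 1 / 2) (hx : |x| ≤ 2) :
    Real.exp (l * x) ≤ 1 + l * x + 4 * l ^ 2 := by
  have habs : |l * x| ≤ l * 2 := by
    rw [abs_mul, abs_of_nonneg hl0]; gcongr
  have h := Real.abs_exp_sub_one_sub_id_le (habs.trans (by linarith))
  have h2 : (l * x) ^ 2 ≤ (l * 2) ^ 2 := sq_le_sq' (abs_le.1 habs).1 (abs_le.1 habs).2
  nlinarith [(abs_le.1 h).2]

/-- Greedy selection of sign matrices whose exponential discrepancy potential grows slowly. -/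
lemma exists_signMatrix_potential_le {m n : ℕ} {M : Matrix (Fin m) (Fin n) ℝ}
    (hM : projNormInfInf M ≤ 1) {l : ℝ} (hl0 : 0 ≤ l) (hl : l ≤ 1 / 2) (t : ℕ) :
    ∃ p : Fin t → (Fin m → Bool) × (Fin n → Bool),
      ∑ a, ∑ b, (Real.exp (l * ∑ i, (signMatrix (p i) a b - M a b)) +
        Real.exp (-(l * ∑ i, (signMatrix (p i) a b - M a b)))) ≤
      2 * m * n * (1 + 4 * l ^ 2) ^ t := by
  induction t with
  | zero =>
    refine ⟨Fin.elim0, ?_⟩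
    simp
    apply le_of_eq; ring
  | succ t ih =>
    obtain ⟨p, hp⟩ := ih
    set S : Matrix (Fin m) (Fin n) ℝ := fun a b => ∑ i, (signMatrix (p i) a b - M a b) with hS
    obtain ⟨q, hq⟩ := exists_signMatrix_le hM
      (fun a b => -(Real.exp (l * S a b) - Real.exp (-(l * S a b))))
    refine ⟨Fin.cons q p, ?_⟩
    simp only [Fin.sum_univ_succ, Fin.cons_zero, Fin.cons_succ]
    have hlin : ∑ a, ∑ b, (Real.exp (l * S a b) - Real.exp (-(l * S a b))) *
        (signMatrix q a b - M a b) ≤ 0 := by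
      simp only [neg_mul, Finset.sum_neg_distrib] at hq
      simp only [mul_sub, Finset.sum_sub_distrib] at hq ⊢
      linarith
    have hterm (a : Fin m) (b : Fin n) :
        Real.exp (l * (signMatrix q a b - M a b + S a b)) +
          Real.exp (-(l * (signMatrix q a b - M a b + S a b))) ≤
        (1 + 4 * l ^ 2) * (Real.exp (l * S a b) + Real.exp (-(l * S a b))) +
          l * ((Real.exp (l * S a b) - Real.exp (-(l * S a b))) *
            (signMatrix q a b - M a b)) := by
      have hx : |signMatrix q a b - M a b| ≤ 2 := by
        have := abs_sub (signMatrix q a b) (M a b)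
        have h1 := abs_signMatrix q a b
        have h2 := abs_le_one_of_projNormInfInf_le hM a b
        linarith
      have e1 := exp_le_one_add_add_four_mul_sq hl0 hl hx
      have e2 := exp_le_one_add_add_four_mul_sq hl0 hl ((abs_neg _).le.trans hx)
      rw [show l * (signMatrix q a b - M a b + S a b) =
          l * (signMatrix q a b - M a b) + l * S a b by ring, neg_add, Real.exp_add,
        Real.exp_add, ← mul_neg]
      have e3 := mul_le_mul_of_nonneg_right e1 (Real.exp_pos (l * S a b)).le
      have e4 := mul_le_mul_of_nonneg_right e2 (Real.exp_pos (-(l * S a b))).le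
      linarith
    calc _ ≤ ∑ a, ∑ b, ((1 + 4 * l ^ 2) * (Real.exp (l * S a b) + Real.exp (-(l * S a b))) +
          l * ((Real.exp (l * S a b) - Real.exp (-(l * S a b))) *
            (signMatrix q a b - M a b))) :=
          Finset.sum_le_sum fun a _ => Finset.sum_le_sum fun b _ => hterm a b
      _ = (1 + 4 * l ^ 2) * ∑ a, ∑ b, (Real.exp (l * S a b) + Real.exp (-(l * S a b))) +
          l * ∑ a, ∑ b, (Real.exp (l * S a b) - Real.exp (-(l * S a b))) *
            (signMatrix q a b - M a b) := by
          simp only [Finset.sum_add_distrib, Finset.mul_sum, mul_add]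
      _ ≤ (1 + 4 * l ^ 2) * (2 * m * n * (1 + 4 * l ^ 2) ^ t) + l * 0 := by
          gcongr
      _ = 2 * m * n * (1 + 4 * l ^ 2) ^ (t + 1) := by ring

/-- Empirical approximation: an element of the projective unit ball is uniformly close to an
average of `t` rank-one sign matrices. -/
lemma exists_signMatrix_approx {m n : ℕ} (hm : 0 < m) (hn : 0 < n)
    {M : Matrix (Fin m) (Fin n) ℝ} (hM : projNormInfInf M ≤ 1) {t : ℕ} (ht : 0 < t) :
    ∃ p : Fin t → (Fin m → Bool) × (Fin n → Bool), ∀ a b,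
      |(∑ i, signMatrix (p i) a b) / t - M a b| ≤ 4 * √(Real.log (2 * m * n) / t) := by
  have ht' : (0 : ℝ) < t := by exact_mod_cast ht
  have hm' : (1 : ℝ) ≤ m := by exact_mod_cast hm
  have hn' : (1 : ℝ) ≤ n := by exact_mod_cast hn
  have hmn : (1 : ℝ) ≤ m * n := one_le_mul_of_one_le_of_one_le hm' hn'
  set L := Real.log (2 * m * n) with hL
  have hLpos : 0 < L := Real.log_pos (by nlinarith)
  set r := √(L / t) with hr
  have hrpos : 0 < r := Real.sqrt_pos.2 (by positivity)
  have hr2 : r ^ 2 * t = L := by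
    rw [hr, Real.sq_sqrt (by positivity)]; field_simp
  by_cases hr1 : r ≤ 1
  · obtain ⟨p, hp⟩ := exists_signMatrix_potential_le hM (l := r / 2) (by positivity)
      (by linarith) t
    refine ⟨p, fun a b => ?_⟩
    set S : Matrix (Fin m) (Fin n) ℝ := fun a b => ∑ i, (signMatrix (p i) a b - M a b) with hS
    have hpos (a b) : 0 ≤ Real.exp (r / 2 * S a b) + Real.exp (-(r / 2 * S a b)) := by
      positivity
    have hle : Real.exp (r / 2 * S a b) + Real.exp (-(r / 2 * S a b)) ≤
        2 * m * n * (1 + 4 * (r / 2) ^ 2) ^ t := by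
      refine le_trans ?_ hp
      refine le_trans ?_ (Finset.single_le_sum (f := fun a =>
        ∑ b, (Real.exp (r / 2 * S a b) + Real.exp (-(r / 2 * S a b))))
        (fun a _ => Finset.sum_nonneg fun b _ => hpos a b) (Finset.mem_univ a))
      exact Finset.single_le_sum (f := fun b =>
        Real.exp (r / 2 * S a b) + Real.exp (-(r / 2 * S a b)))
        (fun b _ => hpos a b) (Finset.mem_univ b)
    have hexp : 2 * m * n * (1 + 4 * (r / 2) ^ 2) ^ t ≤ Real.exp (2 * L) := by
      have h1 : (1 + 4 * (r / 2) ^ 2) ^ t ≤ Real.exp L := by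
        calc (1 + 4 * (r / 2) ^ 2) ^ t ≤ (Real.exp (r ^ 2)) ^ t := by
              gcongr
              have := Real.add_one_le_exp (r ^ 2)
              linarith
          _ = Real.exp L := by rw [← Real.exp_nat_mul, ← hr2, mul_comm]
      have h2 : (2 * m * n : ℝ) = Real.exp L := by
        rw [hL, Real.exp_log (by positivity)]
      rw [two_mul L, Real.exp_add, ← h2]
      rw [← h2] at h1
      gcongr
    have hup : r / 2 * S a b ≤ 2 * L := Real.exp_le_exp.1 <| by
      linarith [Real.exp_pos (-(r / 2 * S a b))]
    have hlow : -(r / 2 * S a b) ≤ 2 * L := Real.exp_le_exp.1 <| by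
      linarith [Real.exp_pos (r / 2 * S a b)]
    have hSb : |S a b| ≤ 4 * r * t := by
      rw [← hr2] at hup hlow
      rw [abs_le]
      constructor <;> refine le_of_mul_le_mul_left ?_ (half_pos hrpos) <;> nlinarith
    have hSe : (∑ i, signMatrix (p i) a b) / t - M a b = S a b / t := by
      simp only [hS, Finset.sum_sub_distrib, Finset.sum_const, Finset.card_univ,
        Fintype.card_fin, nsmul_eq_mul]
      field_simp
    rw [hSe, abs_div, abs_of_pos ht', div_le_iff₀ ht']
    exact hSb
  · refine ⟨fun _ => (fun _ => true, fun _ => true), fun a b => ?_⟩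
    have h2 := abs_le.1 (abs_le_one_of_projNormInfInf_le hM a b)
    have h3 : (∑ i : Fin t, signMatrix ((fun _ => true : Fin m → Bool),
        (fun _ => true : Fin n → Bool)) a b) / t = 1 := by
      simp [signMatrix, boolSign, ht'.ne']
    rw [h3, abs_le]
    constructor <;> linarith

lemma mem_smul_injBall {m n : ℕ} {ε : ℝ} (hε : 0 < ε) {M : Matrix (Fin m) (Fin n) ℝ}
    (hM : ∀ a b, |M a b| ≤ ε) :
    M ∈ ε • {M : Matrix (Fin m) (Fin n) ℝ | injNormInfInf M ≤ 1} := by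
  rw [Set.mem_smul_set_iff_inv_smul_mem₀ hε.ne']
  refine Real.iSup_le (fun a => Real.iSup_le (fun b => ?_) zero_le_one) zero_le_one
  rw [Matrix.smul_apply, smul_eq_mul, abs_mul, abs_of_pos (inv_pos.2 hε), inv_mul_le_iff₀ hε,
    mul_one]
  exact hM a b

/-- A colouring of `D` for which points of equal colour differ by an element of `E` bounds the
packing number. -/
lemma packingNumber_le_card {V : Type*} [AddGroup V] {D E : Set V} {α : Type*} [Fintype α]
    (c : V → α) (hc : ∀ x ∈ D, ∀ y ∈ D, c x = c y → x - y ∈ E) :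
    packingNumber D E ≤ (Fintype.card α : ℕ∞) := by
  refine sSup_le ?_
  rintro _ ⟨l, y, rfl, hy, hsep⟩
  have hinj : Function.Injective fun i => c (y i) := fun i j hij => by
    by_contra hne
    exact hsep i j hne (hc _ (hy i) _ (hy j) hij)
  have := Fintype.card_le_of_injective _ hinj
  rw [Fintype.card_fin] at this
  exact_mod_cast this

lemma entropyNumberBalls_nonneg {V : Type*} [AddCommGroup V] [Module ℝ V] (D E : Set V) (k : ℕ) :
    0 ≤ entropyNumberBalls D E k :=
  Real.sInf_nonneg fun _ h => h.1.le

lemma entropyNumberBalls_succ_le {V : Type*} [AddCommGroup V] [Module ℝ V] {D E : Set V}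
    {α : Type*} [Fintype α] {k : ℕ} {ε : ℝ} (hε : 0 < ε) (c : V → α)
    (hc : ∀ x ∈ D, ∀ y ∈ D, c x = c y → x - y ∈ ε • E) (hk : Fintype.card α ≤ 2 ^ k) :
    entropyNumberBalls D E (k + 1) ≤ ε := by
  refine csInf_le ⟨0, fun _ h => h.1.le⟩ ⟨hε, (packingNumber_le_card c hc).trans ?_⟩
  simpa using (show ((Fintype.card α : ℕ) : ℕ∞) ≤ ((2 ^ k : ℕ) : ℕ∞) by exact_mod_cast hk)

/-- The unit ball of the projective norm. -/
abbrev projBall (m n : ℕ) : Set (Matrix (Fin m) (Fin n) ℝ) := {M | projNormInfInf M ≤ 1}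

/-- The unit ball of the injective norm. -/
abbrev injBall (m n : ℕ) : Set (Matrix (Fin m) (Fin n) ℝ) := {M | injNormInfInf M ≤ 1}

lemma entropy_le_two (m n k : ℕ) :
    entropyNumberBalls (projBall m n) (injBall m n) (k + 1) ≤ 2 := by
  refine entropyNumberBalls_succ_le (α := Unit) two_pos (fun _ => ()) ?_
    (by simpa using Nat.one_le_two_pow)
  intro x hx y hy _
  refine mem_smul_injBall two_pos fun a b => ?_
  have h1 := abs_le_one_of_projNormInfInf_le hx a b
  have h2 := abs_le_one_of_projNormInfInf_le hy a b
  exact (abs_sub _ _).trans (by linarith)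

lemma entropy_le_sqrt_of_mul_le {m n : ℕ} (hm : 0 < m) (hn : 0 < n) {t k : ℕ} (ht : 0 < t)
    (hk : (m + n) * t ≤ k) :
    entropyNumberBalls (projBall m n) (injBall m n) (k + 1) ≤
      8 * √(Real.log (2 * m * n) / t) := by
  classical
  have ht' : (0 : ℝ) < t := by exact_mod_cast ht
  have hm' : (1 : ℝ) ≤ m := by exact_mod_cast hm
  have hn' : (1 : ℝ) ≤ n := by exact_mod_cast hn
  have hL : 0 < Real.log (2 * m * n) := Real.log_pos (by nlinarith)
  have hpos : 0 < 8 * √(Real.log (2 * m * n) / t) := by positivity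
  choose! p hp using fun (M : Matrix (Fin m) (Fin n) ℝ) (hM : projNormInfInf M ≤ 1) =>
    exists_signMatrix_approx hm hn hM ht
  refine entropyNumberBalls_succ_le hpos p ?_ ?_
  · intro x hx y hy hxy
    refine mem_smul_injBall hpos fun a b => ?_
    have h1 := abs_le.1 (hp x hx a b)
    have h2 := abs_le.1 (hp y hy a b)
    rw [hxy] at h1
    rw [Matrix.sub_apply, abs_le]
    constructor <;> linarith
  · simp only [Fintype.card_pi, Fintype.card_prod, Fintype.card_bool, Finset.prod_const,
      Finset.card_univ, Fintype.card_fin]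
    rw [← pow_add, ← pow_mul]
    exact Nat.pow_le_pow_right two_pos hk

lemma entropy_le_of_grid (m n : ℕ) {j k : ℕ} (hk : m * n * (j + 2) ≤ k) :
    entropyNumberBalls (projBall m n) (injBall m n) (k + 1) ≤ (1 / 2) ^ j := by
  classical
  have hpos : (0 : ℝ) < (1 / 2) ^ j := by positivity
  set c : Matrix (Fin m) (Fin n) ℝ → (Fin m → Fin n → Fin (2 ^ (j + 2))) := fun M a b =>
    Fin.ofNat _ ⌊(M a b + 1) * 2 ^ j⌋₊ with hc
  refine entropyNumberBalls_succ_le hpos c ?_ ?_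
  · intro x hx y hy hxy
    refine mem_smul_injBall hpos fun a b => ?_
    have hfloor (z : Matrix (Fin m) (Fin n) ℝ) (hz : projNormInfInf z ≤ 1) :
        0 ≤ (z a b + 1) * 2 ^ j ∧ ⌊(z a b + 1) * 2 ^ j⌋₊ < 2 ^ (j + 2) := by
      have h := abs_le.1 (abs_le_one_of_projNormInfInf_le hz a b)
      have h0 : 0 ≤ (z a b + 1) * 2 ^ j := mul_nonneg (by linarith) (by positivity)
      refine ⟨h0, (Nat.floor_lt h0).2 ?_⟩
      push_cast
      have : (0 : ℝ) < 2 ^ j := by positivity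
      rw [pow_add]
      nlinarith
    obtain ⟨hx0, hxl⟩ := hfloor x hx
    obtain ⟨hy0, hyl⟩ := hfloor y hy
    have heq := congrArg Fin.val (congrFun (congrFun hxy a) b)
    simp only [hc, Fin.val_ofNat, Nat.mod_eq_of_lt hxl, Nat.mod_eq_of_lt hyl] at heq
    have h1 := Nat.floor_le hx0
    have h2 := Nat.lt_floor_add_one ((x a b + 1) * 2 ^ j)
    have h3 := Nat.floor_le hy0
    have h4 := Nat.lt_floor_add_one ((y a b + 1) * 2 ^ j)
    rw [heq] at h1 h2
    have h2j : (0 : ℝ) < 2 ^ j := by positivity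
    rw [Matrix.sub_apply, one_div, inv_pow, ← one_div, le_div_iff₀ h2j]
    rw [← abs_of_pos h2j, ← abs_mul, abs_le]
    constructor <;> linarith
  · simp only [Fintype.card_pi, Finset.prod_const, Finset.card_univ, Fintype.card_fin]
    rw [← pow_mul, ← pow_mul]
    exact Nat.pow_le_pow_right two_pos (by nlinarith)

lemma entropy_le_sqrt {m n : ℕ} (hm : 0 < m) (hn : 0 < n) (k : ℕ) :
    entropyNumberBalls (projBall m n) (injBall m n) (k + 1) ≤
      8 * √(2 * (m + n) * Real.log (2 * m * n)) / √(k + 1) := by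
  have hm' : (1 : ℝ) ≤ m := by exact_mod_cast hm
  have hn' : (1 : ℝ) ≤ n := by exact_mod_cast hn
  have hmn : (1 : ℝ) ≤ m * n := one_le_mul_of_one_le_of_one_le hm' hn'
  have hL : 1 / 2 ≤ Real.log (2 * m * n) := by
    have := Real.log_two_gt_d9
    have h2 : Real.log 2 ≤ Real.log (2 * m * n) := Real.log_le_log two_pos (by nlinarith)
    linarith
  rw [mul_div_assoc, ← Real.sqrt_div' _ (by positivity)]
  by_cases hk : k < m + n
  · refine (entropy_le_two m n k).trans ?_
    have h1 : (1 : ℝ) ≤ √(2 * (m + n) * Real.log (2 * m * n) / (k + 1)) := by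
      rw [Real.one_le_sqrt, one_le_div (by positivity)]
      have : (k : ℝ) + 1 ≤ m + n := by exact_mod_cast hk
      nlinarith
    linarith
  · push Not at hk
    have hs : 0 < m + n := by omega
    have ht : 0 < k / (m + n) := Nat.div_pos hk hs
    refine (entropy_le_sqrt_of_mul_le hm hn ht (Nat.mul_div_le k (m + n))).trans ?_
    have ht' : (0 : ℝ) < ((k / (m + n) : ℕ) : ℝ) := by exact_mod_cast ht
    have hlt : k + 1 ≤ 2 * (m + n) * (k / (m + n)) := by
      have := Nat.lt_mul_div_succ k hs
      nlinarith
    have hlt' : (k : ℝ) + 1 ≤ 2 * (m + n) * ((k / (m + n) : ℕ) : ℝ) := by exact_mod_cast hlt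
    gcongr 8 * √?_
    rw [div_le_div_iff₀ ht' (by positivity)]
    nlinarith

lemma pow_four_le_mul_two_pow (q : ℕ) : q ^ 4 ≤ 32 * 2 ^ q := by
  by_cases hq : q ≤ 6
  · interval_cases q <;> norm_num
  · push Not at hq
    induction q, hq.le using Nat.le_induction with
    | base => norm_num
    | succ q h ih =>
      have ih' : q ^ 4 ≤ 32 * 2 ^ q := by
        rcases h.eq_or_lt with rfl | h'
        · norm_num
        · exact ih h'
      have : (q + 1) ^ 4 ≤ 2 * q ^ 4 := by
        obtain ⟨r, rfl⟩ := Nat.exists_eq_add_of_le h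
        ring_nf
        nlinarith [sq_nonneg r]
      rw [pow_succ 2]
      omega

lemma entropy_le_pow_four {m n : ℕ} (hm : 0 < m) (hn : 0 < n) (k : ℕ) :
    entropyNumberBalls (projBall m n) (injBall m n) (k + 1) ≤
      256 * ((m * n) / (k + 1) : ℝ) ^ 4 := by
  have hd : 0 < m * n := Nat.mul_pos hm hn
  set t := k / (m * n) with ht
  have h1 : entropyNumberBalls (projBall m n) (injBall m n) (k + 1) ≤ 8 * (1 / 2) ^ (t + 1) := by
    by_cases h : t < 2
    · refine (entropy_le_two m n k).trans ?_
      interval_cases t <;> norm_num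
    · push Not at h
      obtain ⟨j, hj⟩ := Nat.exists_eq_add_of_le h
      refine (entropy_le_of_grid m n (j := j) ?_).trans (le_of_eq ?_)
      · rw [add_comm j, ← hj]; exact Nat.mul_div_le k _
      · rw [hj]; ring
  refine h1.trans ?_
  have h2 : k + 1 ≤ m * n * (t + 1) := Nat.lt_mul_div_succ k hd
  have h2' : (k : ℝ) + 1 ≤ m * n * (t + 1) := by exact_mod_cast h2
  have h3 : ((t : ℝ) + 1) ^ 4 ≤ 32 * 2 ^ (t + 1) := by
    exact_mod_cast pow_four_le_mul_two_pow (t + 1)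
  have h4 : ((k : ℝ) + 1) ^ 4 ≤ (m * n) ^ 4 * (32 * 2 ^ (t + 1)) := by
    calc ((k : ℝ) + 1) ^ 4 ≤ ((m : ℝ) * n * (t + 1)) ^ 4 := by gcongr
      _ = ((m : ℝ) * n) ^ 4 * ((t : ℝ) + 1) ^ 4 := by ring
      _ ≤ _ := by gcongr
  rw [one_div, inv_pow, div_pow, ← mul_div_assoc, ← div_eq_mul_inv,
    div_le_div_iff₀ (by positivity) (by positivity)]
  linarith

lemma sum_range_inv_sq_le (N : ℕ) :
    ∑ k ∈ Finset.range N, (1 : ℝ) / (k + 1) ^ 2 ≤ 2 - 1 / (N : ℝ) := by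
  induction N with
  | zero => simp
  | succ N ih =>
    rw [Finset.sum_range_succ]
    rcases N.eq_zero_or_pos with rfl | hN
    · norm_num
    · have hN' : (0 : ℝ) < N := by exact_mod_cast hN
      have : (1 : ℝ) / (N + 1) ^ 2 ≤ 1 / N - 1 / (N + 1) := by
        rw [div_sub_div _ _ hN'.ne' (by positivity), div_le_div_iff₀ (by positivity)
          (by positivity)]
        nlinarith
      push_cast
      linarith

lemma sum_range_inv_le_log (N : ℕ) :
    ∑ k ∈ Finset.range N, (1 : ℝ) / (k + 1) ≤ 1 + Real.log N := by
  have := harmonic_le_one_add_log N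
  simpa [harmonic, one_div] using this

lemma entropy_div_sqrt_le {m n : ℕ} (hm : 0 < m) (hn : 0 < n) (k : ℕ) :
    entropyNumberBalls (projBall m n) (injBall m n) (k + 1) / √(k + 1) ≤
      (if k < (m * n) ^ 2 then
        8 * √(2 * (m + n) * Real.log (2 * m * n)) * (1 / (k + 1)) else 0) +
        256 * (1 / (k + 1) ^ 2) := by
  have hk0 : (0 : ℝ) < k + 1 := by positivity
  split_ifs with hk
  · calc _ ≤ 8 * √(2 * (m + n) * Real.log (2 * m * n)) / √(k + 1) / √(k + 1) := by
          gcongr; exact entropy_le_sqrt hm hn k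
      _ = 8 * √(2 * (m + n) * Real.log (2 * m * n)) * (1 / (k + 1)) := by
          rw [div_div, Real.mul_self_sqrt hk0.le]; ring
      _ ≤ _ := le_add_of_nonneg_right (by positivity)
  · push Not at hk
    have hk' : ((m : ℝ) * n) ^ 2 ≤ k + 1 := by
      have : ((m : ℝ) * n) ^ 2 ≤ k := by exact_mod_cast hk
      linarith
    rw [zero_add]
    have hs : 1 ≤ √((k : ℝ) + 1) := by
      rw [Real.one_le_sqrt]; linarith [(Nat.cast_nonneg k : (0 : ℝ) ≤ k)]
    refine (div_le_self (entropyNumberBalls_nonneg _ _ _) hs).trans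
      ((entropy_le_pow_four hm hn k).trans ?_)
    gcongr
    rw [div_pow, div_le_div_iff₀ (by positivity) (by positivity)]
    calc ((m : ℝ) * n) ^ 4 * (k + 1) ^ 2 = (((m : ℝ) * n) ^ 2) ^ 2 * (k + 1) ^ 2 := by ring
      _ ≤ ((k : ℝ) + 1) ^ 2 * (k + 1) ^ 2 := by gcongr
      _ = 1 * ((k : ℝ) + 1) ^ 4 := by ring

lemma sum_range_entropy_le {m n : ℕ} (hm : 0 < m) (hn : 0 < n) (N : ℕ) :
    ∑ k ∈ Finset.range N,
        entropyNumberBalls (projBall m n) (injBall m n) (k + 1) / √(k + 1) ≤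
      8 * √(2 * (m + n) * Real.log (2 * m * n)) * (1 + 2 * Real.log (m * n)) + 512 := by
  refine (Finset.sum_le_sum fun k _ => entropy_div_sqrt_le hm hn k).trans ?_
  rw [Finset.sum_add_distrib, ← Finset.sum_filter, ← Finset.mul_sum, ← Finset.mul_sum]
  refine add_le_add ?_ ?_
  · gcongr
    calc _ ≤ ∑ k ∈ Finset.range ((m * n) ^ 2), (1 : ℝ) / (k + 1) :=
          Finset.sum_le_sum_of_subset_of_nonneg (fun k hk => by simp_all)
            fun _ _ _ => by positivity
      _ ≤ 1 + Real.log ((m * n) ^ 2 : ℕ) := sum_range_inv_le_log _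
      _ = 1 + 2 * Real.log (m * n) := by
          push_cast
          rw [Real.log_pow]
          norm_num
  · have := sum_range_inv_sq_le N
    have h0 : (0 : ℝ) ≤ 1 / (N : ℝ) := by positivity
    linarith

theorem stmt_11 :
    ∃ C : ℝ, 0 < C ∧
    ∀ (m n : ℕ), 0 < m → 0 < n →
      E21balls {M : Matrix (Fin m) (Fin n) ℝ | projNormInfInf M ≤ 1}
          {M : Matrix (Fin m) (Fin n) ℝ | injNormInfInf M ≤ 1}
        ≤ C * Real.sqrt (1 + m + n) * (1 + Real.log m + Real.log n) ^ ((3:ℝ)/2) := by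
  refine ⟨544, by norm_num, fun m n hm hn => ?_⟩
  have hm' : (1 : ℝ) ≤ m := by exact_mod_cast hm
  have hn' : (1 : ℝ) ≤ n := by exact_mod_cast hn
  have hlm := Real.log_nonneg hm'
  have hln := Real.log_nonneg hn'
  have hlog : Real.log (m * n) = Real.log m + Real.log n :=
    Real.log_mul (by positivity) (by positivity)
  have hlog2 : Real.log (2 * m * n) = Real.log 2 + Real.log m + Real.log n := by
    rw [Real.log_mul (by positivity) (by positivity), Real.log_mul (by positivity) (by positivity)]
  set Λ := 1 + Real.log m + Real.log n with hΛ
  have hΛ1 : 1 ≤ Λ := by linarith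
  have hpow : Λ ^ ((3 : ℝ) / 2) = √Λ * Λ := by
    rw [show (3 : ℝ) / 2 = 1 / 2 + 1 by norm_num, Real.rpow_add (by linarith), Real.rpow_one,
      Real.sqrt_eq_rpow]
  have hs1 : 1 ≤ √Λ := Real.one_le_sqrt.2 hΛ1
  have hs2 : 1 ≤ √(1 + m + n : ℝ) := Real.one_le_sqrt.2 (by linarith)
  refine Real.tsum_le_of_sum_range_le
    (fun k => div_nonneg (entropyNumberBalls_nonneg _ _ _) (Real.sqrt_nonneg _)) fun N => ?_
  refine (sum_range_entropy_le hm hn N).trans ?_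
  have hsqrt : √(2 * (m + n) * Real.log (2 * m * n)) ≤ 2 * (√(1 + m + n) * √Λ) := by
    rw [← Real.sqrt_mul (by positivity)]
    refine Real.sqrt_le_iff.2 ⟨by positivity, ?_⟩
    rw [mul_pow, Real.sq_sqrt (by positivity)]
    have : Real.log (2 * m * n) ≤ Λ := by
      have := Real.log_two_lt_d9
      linarith
    have h0 : 0 ≤ Real.log (2 * m * n) := by
      have := Real.log_two_gt_d9
      linarith
    calc 2 * ((m : ℝ) + n) * Real.log (2 * m * n) ≤ 4 * (1 + m + n) * Λ := by
          gcongr ?_ * ?_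
          linarith
      _ = _ := by ring
  have hfac : 1 + 2 * Real.log (m * n) ≤ 2 * Λ := by linarith
  have hone : 1 ≤ √(1 + m + n : ℝ) * (√Λ * Λ) :=
    one_le_mul_of_one_le_of_one_le hs2 (one_le_mul_of_one_le_of_one_le hs1 hΛ1)
  rw [hpow]
  calc _ ≤ 8 * (2 * (√(1 + m + n : ℝ) * √Λ)) * (2 * Λ) + 512 := by
        gcongr
        rw [hlog]; linarith
    _ ≤ 544 * √(1 + m + n : ℝ) * (√Λ * Λ) := by linarith
end

section
/- There exists an absolute constant C such that the following holds. Let d1, d2, L, r be positive integers, let j_k ∈ [d2] satisfy j_k ≡ k modulo d2 for k = 1,…,L d2, and let b_1,…,b_{L d2} be i.i.d. N(0, I_{d1}) Gaussian vectors. Then for every ζ ∈ (0,1), with probability at least 1−ζ, sup_{|||M|||≤1} | ‖M‖_F² − (1/L) Σ_{k=1}^{L d2} (b_kᵀ M e_{j_k})² | ≤ C d2 · max(t, √t), where t := max(r(d1+d2) log³(d1+d2), log(2/ζ)) / (L d2). -/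
open MeasureTheory ProbabilityTheory Matrix Real Set
open scoped ENNReal NNReal

noncomputable def frobNorm {m n : ℕ} (M : Matrix (Fin m) (Fin n) ℝ) : ℝ :=
  Real.sqrt (∑ i, ∑ j, (M i j)^2)

/-- maximum ℓ2 norm of the columns of `M`, i.e. `‖M‖_{1→2}` -/
noncomputable def norm12 {m n : ℕ} (M : Matrix (Fin m) (Fin n) ℝ) : ℝ :=
  ⨆ j, Real.sqrt (∑ i, (M i j)^2)

/-- `‖M‖_mixed = inf { ‖U‖_F ‖Vᵀ‖_{1→2} : M = U Vᵀ }` -/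
noncomputable def mixedNorm {d1 d2 : ℕ} (M : Matrix (Fin d1) (Fin d2) ℝ) : ℝ :=
  sInf {c | ∃ (d : ℕ) (U : Matrix (Fin d1) (Fin d) ℝ) (V : Matrix (Fin d2) (Fin d) ℝ),
    M = U * Vᵀ ∧ c = frobNorm U * norm12 Vᵀ}

/-- `|||M||| = max(‖M‖_{1→2}, ‖M‖_mixed / √r)` -/
noncomputable def tripleNorm {d1 d2 : ℕ} (r : ℕ) (M : Matrix (Fin d1) (Fin d2) ℝ) : ℝ :=
  max (norm12 M) (mixedNorm M / Real.sqrt r)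

lemma neg_log_one_sub_le {u : ℝ} (hu : |u| ≤ 1 / 4) : -u - Real.log (1 - 2 * u) / 2 ≤ 4 * u ^ 2 := by
  have h2 : |2 * u| ≤ 1 / 2 := by rw [abs_mul, abs_two]; linarith
  have h := Real.abs_log_sub_add_sum_range_le (x := 2 * u) (by linarith) 1
  simp only [Finset.sum_range_one, zero_add, pow_one, Nat.cast_zero, div_one] at h
  have h3 : |2 * u| ^ (1 + 1) / (1 - |2 * u|) ≤ 8 * u ^ 2 := by
    rw [div_le_iff₀ (by linarith), show (1 + 1 : ℕ) = 2 from rfl, sq_abs]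
    nlinarith [sq_nonneg u]
  have := neg_abs_le (2 * u + Real.log (1 - 2 * u))
  linarith

lemma exp_sq_stdGaussian {u : ℝ} (hu : |u| ≤ 1 / 4) :
    Integrable (fun x : ℝ => Real.exp (u * (x ^ 2 - 1))) (gaussianReal 0 1) ∧
    ∫ x, Real.exp (u * (x ^ 2 - 1)) ∂(gaussianReal 0 1) ≤ Real.exp (4 * u ^ 2) := by
  have hu' := abs_le.1 hu
  have hb : 0 < 1 / 2 - u := by linarith
  have hpdf : ∀ x : ℝ, gaussianPDFReal 0 1 x • Real.exp (u * (x ^ 2 - 1)) =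
      ((√(2 * π))⁻¹ * Real.exp (-u)) * Real.exp (-(1 / 2 - u) * x ^ 2) := by
    intro x
    simp only [gaussianPDFReal, smul_eq_mul, NNReal.coe_one, mul_one, sub_zero]
    rw [mul_assoc, mul_assoc, ← Real.exp_add, ← Real.exp_add]
    congr 2
    ring
  constructor
  · rw [gaussianReal_of_var_ne_zero _ one_ne_zero, integrable_withDensity_iff_integrable_smul'
      (measurable_gaussianPDF _ _) (ae_of_all _ fun _ => gaussianPDF_lt_top)]
    simp only [toReal_gaussianPDF, hpdf]
    exact (integrable_exp_neg_mul_sq hb).const_mul _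
  · rw [integral_gaussianReal_eq_integral_smul one_ne_zero]
    simp only [hpdf]
    rw [integral_const_mul, integral_gaussian]
    have h1 : 0 < 1 - 2 * u := by linarith
    have : (√(2 * π))⁻¹ * Real.exp (-u) * √(π / (1 / 2 - u)) =
        Real.exp (-u - Real.log (1 - 2 * u) / 2) := by
      have e : π / (1 / 2 - u) = (2 * π) / (1 - 2 * u) := by
        field_simp
      rw [e, Real.sqrt_div (by positivity), Real.exp_sub, ← Real.log_sqrt h1.le,
        Real.exp_log (Real.sqrt_pos.2 h1)]
      have : √(2 * π) ≠ 0 := by positivity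
      field_simp
    rw [this]
    exact Real.exp_le_exp.2 (neg_log_one_sub_le hu)

lemma map_dot_pi_gaussian {d : ℕ} (h : Fin d → ℝ) :
    (Measure.pi (fun _ : Fin d => gaussianReal 0 1)).map (fun x => ∑ i, x i * h i) =
      gaussianReal 0 (∑ i, h i ^ 2).toNNReal := by
  let T : StrongDual ℝ (EuclideanSpace ℝ (Fin d)) := innerSL ℝ (WithLp.toLp 2 h)
  have hT : (fun x : Fin d → ℝ => ∑ i, x i * h i) = T ∘ (WithLp.toLp 2) := by
    ext x
    simp [T, PiLp.inner_apply]
  rw [hT, ← Measure.map_map (by fun_prop) (by fun_prop), map_pi_eq_stdGaussian,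
    IsGaussian.map_eq_gaussianReal, integral_strongDual_stdGaussian, variance_dual_stdGaussian,
    innerSL_apply_norm, EuclideanSpace.real_norm_sq_eq]

lemma gaussianReal_eq_map_sqrt (w : ℝ≥0) :
    gaussianReal 0 w = (gaussianReal 0 1).map (fun x => √w * x) := by
  rw [gaussianReal_map_const_mul, mul_zero, mul_one]
  congr
  ext
  simp

lemma exp_sq_dot_gaussian {d : ℕ} (h : Fin d → ℝ) {u : ℝ} (hu : |u| ≤ 1 / 4)
    (hh : ∑ i, h i ^ 2 ≤ 1) :
    Integrable (fun x : Fin d → ℝ => Real.exp (u * ((∑ i, x i * h i) ^ 2 - ∑ i, h i ^ 2)))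
      (Measure.pi (fun _ : Fin d => gaussianReal 0 1)) ∧
    ∫ x, Real.exp (u * ((∑ i, x i * h i) ^ 2 - ∑ i, h i ^ 2))
      ∂(Measure.pi (fun _ : Fin d => gaussianReal 0 1)) ≤ Real.exp (4 * u ^ 2) := by
  set w := ∑ i, h i ^ 2 with hw
  have hw0 : 0 ≤ w := Finset.sum_nonneg fun i _ => sq_nonneg _
  have hmap : (Measure.pi (fun _ : Fin d => gaussianReal 0 1)).map (fun x => ∑ i, x i * h i) =
      (gaussianReal 0 1).map (fun x => √w * x) := by
    rw [map_dot_pi_gaussian, gaussianReal_eq_map_sqrt, Real.coe_toNNReal _ hw0]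
  have huw : |u * w| ≤ 1 / 4 := by
    rw [abs_mul, abs_of_nonneg hw0]
    nlinarith [abs_nonneg u]
  obtain ⟨hi, hle⟩ := exp_sq_stdGaussian huw
  have hf : Measurable (fun y : ℝ => Real.exp (u * (y ^ 2 - w))) := by fun_prop
  have hcomp : (fun y : ℝ => Real.exp (u * (y ^ 2 - w))) ∘ (fun x => √w * x) =
      fun x => Real.exp (u * w * (x ^ 2 - 1)) := by
    ext x
    simp only [Function.comp_apply, mul_pow, Real.sq_sqrt hw0]
    ring_nf
  have m1 : Measurable (fun x : Fin d → ℝ => ∑ i, x i * h i) := by fun_prop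
  have m2 : Measurable (fun x : ℝ => √w * x) := by fun_prop
  constructor
  · have := (integrable_map_measure (μ := gaussianReal 0 1) hf.aestronglyMeasurable
      m2.aemeasurable).2 (by rw [hcomp]; exact hi)
    rw [← hmap] at this
    exact this.comp_measurable m1
  · have e1 := integral_map (μ := Measure.pi (fun _ : Fin d => gaussianReal 0 1))
      m1.aemeasurable hf.aestronglyMeasurable
    have e2 := integral_map (μ := gaussianReal 0 1) m2.aemeasurable hf.aestronglyMeasurable
    rw [hmap, e2] at e1
    rw [← e1]
    refine le_trans (le_of_eq (integral_congr_ae (ae_of_all _ fun x => congrFun hcomp x)))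
      (hle.trans (Real.exp_le_exp.2 ?_))
    have : w ^ 2 ≤ 1 := by nlinarith
    nlinarith [sq_nonneg u]

lemma exp_chernoff {n : ℕ} {d : ℕ} (h : Fin n → Fin d → ℝ) (hh : ∀ k, ∑ i, h k i ^ 2 ≤ 1)
    {u : ℝ} (hu : |u| ≤ 1 / 4) :
    Integrable (fun β : Fin n → Fin d → ℝ =>
      Real.exp (u * ∑ k, ((∑ i, β k i * h k i) ^ 2 - ∑ i, h k i ^ 2)))
      (Measure.pi (fun _ : Fin n => Measure.pi (fun _ : Fin d => gaussianReal 0 1))) ∧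
    mgf (fun β : Fin n → Fin d → ℝ => ∑ k, ((∑ i, β k i * h k i) ^ 2 - ∑ i, h k i ^ 2))
      (Measure.pi (fun _ : Fin n => Measure.pi (fun _ : Fin d => gaussianReal 0 1))) u
      ≤ Real.exp (4 * u ^ 2 * n) := by
  set ν := Measure.pi (fun _ : Fin d => gaussianReal 0 1)
  set μ := Measure.pi (fun _ : Fin n => ν)
  let Y : Fin n → (Fin d → ℝ) → ℝ := fun k x => (∑ i, x i * h k i) ^ 2 - ∑ i, h k i ^ 2
  have hY : ∀ k, Measurable (Y k) := fun k => by fun_prop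
  let X : Fin n → (Fin n → Fin d → ℝ) → ℝ := fun k β => Y k (β k)
  have hX : ∀ k, Measurable (X k) := fun k => (hY k).comp (measurable_pi_apply k)
  have hind : iIndepFun X μ := iIndepFun_pi fun k => (hY k).aemeasurable
  have hexp_int : ∀ k, Integrable (fun β => Real.exp (u * X k β)) μ := fun k =>
    (measurePreserving_eval (fun _ : Fin n => ν) k).integrable_comp_of_integrable
      (exp_sq_dot_gaussian (h k) hu (hh k)).1
  have hsum : (fun β : Fin n → Fin d → ℝ => ∑ k, ((∑ i, β k i * h k i) ^ 2 - ∑ i, h k i ^ 2)) =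
      ∑ k, X k := by
    ext β; simp [X, Y]
  constructor
  · have := hind.integrable_exp_mul_sum hX (s := Finset.univ) (t := u) fun k _ => hexp_int k
    simpa [X, Y] using this
  · rw [hsum, hind.mgf_sum hX]
    have hk : ∀ k, mgf (X k) μ u ≤ Real.exp (4 * u ^ 2) := by
      intro k
      refine le_trans (le_of_eq ?_) (exp_sq_dot_gaussian (h k) hu (hh k)).2
      have hm := (measurePreserving_eval (fun _ : Fin n => ν) k)
      rw [mgf]
      change _ = ∫ x, Real.exp (u * Y k x) ∂ν
      conv_rhs => rw [← hm.map_eq]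
      rw [integral_map hm.measurable.aemeasurable (by have := hY k; fun_prop)]
    calc ∏ k, mgf (X k) μ u ≤ ∏ _k : Fin n, Real.exp (4 * u ^ 2) :=
          Finset.prod_le_prod (fun k _ => mgf_nonneg) fun k _ => hk k
      _ = Real.exp (4 * u ^ 2 * n) := by
          rw [Finset.prod_const, Finset.card_univ, Fintype.card_fin, ← Real.exp_nat_mul]
          ring_nf

lemma chernoff_exponent {n τ : ℝ} (hn : 0 ≤ n) (hτ : 0 ≤ τ) :
    ∃ u : ℝ, 0 ≤ u ∧ u ≤ 1 / 4 ∧ -u * (8 * n * max τ (√τ)) + 4 * u ^ 2 * n ≤ -(n * τ) := by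
  rcases le_total τ 1 with h | h
  · have hs : τ ≤ √τ := Real.le_sqrt_of_sq_le (by nlinarith)
    have h1 : √τ ≤ 1 := Real.sqrt_le_one.2 h
    refine ⟨√τ / 4, by positivity, by linarith, ?_⟩
    rw [max_eq_right hs]
    have := Real.mul_self_sqrt hτ
    have h2 : -(√τ / 4) * (8 * n * √τ) + 4 * (√τ / 4) ^ 2 * n = - (7 / 4) * n * (√τ * √τ) := by ring
    rw [h2, this]
    nlinarith [mul_nonneg hn hτ]
  · have hs : √τ ≤ τ := Real.sqrt_le_iff.2 ⟨hτ, by nlinarith⟩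
    refine ⟨1 / 4, by norm_num, le_rfl, ?_⟩
    rw [max_eq_left hs]
    nlinarith [mul_nonneg hn hτ, mul_le_mul_of_nonneg_left h hn]

/-- Bernstein-type tail bound for a sum of independent squared Gaussian functionals. -/
lemma gaussian_square_tail {n : ℕ} {d : ℕ} (h : Fin n → Fin d → ℝ) (hh : ∀ k, ∑ i, h k i ^ 2 ≤ 1)
    {τ : ℝ} (hτ : 0 ≤ τ) :
    (Measure.pi (fun _ : Fin n => Measure.pi (fun _ : Fin d => gaussianReal 0 1))).real
      {β | 8 * n * max τ (√τ) ≤ |∑ k, ((∑ i, β k i * h k i) ^ 2 - ∑ i, h k i ^ 2)|}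
      ≤ 2 * Real.exp (-(n * τ)) := by
  set μ := Measure.pi (fun _ : Fin n => Measure.pi (fun _ : Fin d => gaussianReal 0 1))
  obtain ⟨u, hu0, hu1, hu⟩ := chernoff_exponent (Nat.cast_nonneg n) hτ
  set ε := 8 * n * max τ (√τ)
  set X : (Fin n → Fin d → ℝ) → ℝ :=
    fun β => ∑ k, ((∑ i, β k i * h k i) ^ 2 - ∑ i, h k i ^ 2)
  obtain ⟨i1, m1⟩ := exp_chernoff h hh (u := u) (by rw [abs_of_nonneg hu0]; exact hu1)
  obtain ⟨i2, m2⟩ := exp_chernoff h hh (u := -u) (by rw [abs_neg, abs_of_nonneg hu0]; exact hu1)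
  have t1 : μ.real {β | ε ≤ X β} ≤ Real.exp (-(n * τ)) := by
    refine (measure_ge_le_exp_mul_mgf ε hu0 i1).trans ?_
    refine (mul_le_mul_of_nonneg_left m1 (Real.exp_pos _).le).trans ?_
    rw [← Real.exp_add]
    exact Real.exp_le_exp.2 hu
  have t2 : μ.real {β | X β ≤ -ε} ≤ Real.exp (-(n * τ)) := by
    refine (measure_le_le_exp_mul_mgf (-ε) (by linarith : -u ≤ 0) i2).trans ?_
    refine (mul_le_mul_of_nonneg_left m2 (Real.exp_pos _).le).trans ?_
    rw [← Real.exp_add]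
    refine Real.exp_le_exp.2 (le_trans (le_of_eq ?_) hu)
    ring
  have hsub : {β | ε ≤ |X β|} ⊆ {β | ε ≤ X β} ∪ {β | X β ≤ -ε} := by
    intro β hβ
    rcases le_abs.1 (show ε ≤ |X β| from hβ) with h | h
    · exact Or.inl h
    · exact Or.inr (show X β ≤ -ε by linarith)
  calc μ.real {β | ε ≤ |X β|} ≤ μ.real ({β | ε ≤ X β} ∪ {β | X β ≤ -ε}) := measureReal_mono hsub
    _ ≤ _ := measureReal_union_le _ _
    _ ≤ _ := by linarith

lemma exists_finset_grid {ι : Type*} [Fintype ι] (P : Set (ι → ℝ)) (hP : ∀ p ∈ P, ∀ i, |p i| ≤ 1)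
    {m : ℕ} (hm : 0 < m) :
    ∃ N : Finset (ι → ℝ), (∀ p ∈ N, p ∈ P) ∧ N.card ≤ (2 * m + 1) ^ Fintype.card ι ∧
      ∀ p ∈ P, ∃ p' ∈ N, ∀ i, |p i - p' i| ≤ 1 / m := by
  classical
  have hm' : (0 : ℝ) < m := by exact_mod_cast hm
  let code : (ι → ℝ) → ι → ℤ := fun p i => ⌊(m : ℝ) * p i⌋
  let K : Finset (ι → ℤ) := Fintype.piFinset fun _ => Finset.Icc (-(m : ℤ)) m
  have hcode : ∀ p ∈ P, code p ∈ K := by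
    intro p hp
    refine Fintype.mem_piFinset.2 fun i => Finset.mem_Icc.2 ?_
    have := abs_le.1 (hP p hp i)
    refine ⟨Int.le_floor.2 ?_, Int.cast_le (R := ℝ).1 ((Int.floor_le _).trans ?_)⟩
    · push_cast; nlinarith
    · push_cast; nlinarith
  have hcard : K.card = (2 * m + 1) ^ Fintype.card ι := by
    rw [Fintype.card_piFinset, Finset.prod_const, Finset.card_univ, Int.card_Icc]
    congr 1
    omega
  let rep : (ι → ℤ) → (ι → ℝ) := fun c =>
    if h : ∃ p ∈ P, code p = c then h.choose else 0
  refine ⟨(K.filter fun c => ∃ p ∈ P, code p = c).image rep, ?_, ?_, ?_⟩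
  · intro p hp
    obtain ⟨c, hc, rfl⟩ := Finset.mem_image.1 hp
    have h := (Finset.mem_filter.1 hc).2
    simp only [rep, dif_pos h]
    exact h.choose_spec.1
  · rw [← hcard]
    exact Finset.card_image_le.trans (Finset.card_filter_le _ _)
  · intro p hp
    have h : ∃ p' ∈ P, code p' = code p := ⟨p, hp, rfl⟩
    refine ⟨rep (code p), Finset.mem_image_of_mem _ (Finset.mem_filter.2 ⟨hcode p hp, h⟩), ?_⟩
    simp only [rep, dif_pos h]
    intro i
    have h1 : ⌊(m : ℝ) * h.choose i⌋ = ⌊(m : ℝ) * p i⌋ := congrFun h.choose_spec.2 i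
    have h2 := Int.abs_sub_lt_one_of_floor_eq_floor h1
    rw [← mul_sub, abs_mul, abs_of_pos hm'] at h2
    rw [abs_sub_comm, le_div_iff₀ hm']
    linarith

/-- Matrices `W Xᵀ` with inner dimension `k`, all entries of `W` and `X` in `[-1, 1]` and all
columns of Euclidean norm at most one. -/
def boundedLowRank (d1 d2 k : ℕ) : Set (Matrix (Fin d1) (Fin d2) ℝ) :=
  {H | (∃ (W : Fin d1 → Fin k → ℝ) (X : Fin d2 → Fin k → ℝ), (∀ i a, |W i a| ≤ 1) ∧
    (∀ j a, |X j a| ≤ 1) ∧ ∀ i j, H i j = ∑ a, W i a * X j a) ∧ ∀ j, ∑ i, H i j ^ 2 ≤ 1}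

lemma abs_mul_sub_mul_le {a b a' b' ε : ℝ} (ha : |a| ≤ 1) (hb' : |b'| ≤ 1)
    (h1 : |a - a'| ≤ ε) (h2 : |b - b'| ≤ ε) : |a * b - a' * b'| ≤ 2 * ε := by
  have e : a * b - a' * b' = a * (b - b') + (a - a') * b' := by ring
  rw [e]
  refine (abs_add_le _ _).trans ?_
  rw [abs_mul, abs_mul]
  nlinarith [abs_nonneg a, abs_nonneg b', abs_nonneg (b - b'), abs_nonneg (a - a')]

lemma abs_entry_le_of_mem_boundedLowRank {d1 d2 k : ℕ} {H : Matrix (Fin d1) (Fin d2) ℝ}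
    (hH : H ∈ boundedLowRank d1 d2 k) (i : Fin d1) (j : Fin d2) : |H i j| ≤ 1 := by
  rw [← sq_le_one_iff_abs_le_one]
  exact (Finset.single_le_sum (f := fun i => H i j ^ 2) (fun i _ => sq_nonneg _)
    (Finset.mem_univ i)).trans (hH.2 j)

lemma exists_finset_net_boundedLowRank (d1 d2 k : ℕ) {m : ℕ} (hm : 0 < m) :
    ∃ N : Finset (Matrix (Fin d1) (Fin d2) ℝ), (∀ H ∈ N, H ∈ boundedLowRank d1 d2 k) ∧
      N.card ≤ (2 * m + 1) ^ ((d1 + d2) * k) ∧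
      ∀ H ∈ boundedLowRank d1 d2 k, ∃ H' ∈ N, ∀ i j, |H i j - H' i j| ≤ 2 * k / m := by
  classical
  let build : ((Fin d1 ⊕ Fin d2) × Fin k → ℝ) → Matrix (Fin d1) (Fin d2) ℝ :=
    fun p i j => ∑ a, p (Sum.inl i, a) * p (Sum.inr j, a)
  let P : Set ((Fin d1 ⊕ Fin d2) × Fin k → ℝ) :=
    {p | (∀ x, |p x| ≤ 1) ∧ ∀ j, ∑ i, build p i j ^ 2 ≤ 1}
  obtain ⟨N, hNP, hcard, hN⟩ := exists_finset_grid P (fun p hp => hp.1) hm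
  refine ⟨N.image build, ?_, ?_, ?_⟩
  · intro H hH
    obtain ⟨p, hp, rfl⟩ := Finset.mem_image.1 hH
    have := hNP p hp
    exact ⟨⟨fun i a => p (Sum.inl i, a), fun j a => p (Sum.inr j, a), fun _ _ => this.1 _,
      fun _ _ => this.1 _, fun _ _ => rfl⟩, this.2⟩
  · refine Finset.card_image_le.trans (hcard.trans (le_of_eq ?_))
    simp
  · rintro H ⟨⟨W, X, hW, hX, hH⟩, hcol⟩
    let p : (Fin d1 ⊕ Fin d2) × Fin k → ℝ := fun x => Sum.elim (fun i => W i x.2) (fun j => X j x.2) x.1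
    have hb : build p = H := by
      ext i j
      simp [build, p, hH]
    have hp : p ∈ P := by
      refine ⟨?_, by rw [hb]; exact hcol⟩
      rintro ⟨i | j, a⟩
      · exact hW i a
      · exact hX j a
    obtain ⟨p', hp', hd⟩ := hN p hp
    refine ⟨build p', Finset.mem_image_of_mem _ hp', fun i j => ?_⟩
    rw [← hb]
    simp only [build]
    rw [← Finset.sum_sub_distrib]
    refine (Finset.abs_sum_le_sum_abs _ _).trans ?_
    have : ∀ a ∈ (Finset.univ : Finset (Fin k)),
        |p (Sum.inl i, a) * p (Sum.inr j, a) - p' (Sum.inl i, a) * p' (Sum.inr j, a)| ≤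
          2 * (1 / m) := fun a _ =>
      abs_mul_sub_mul_le (hp.1 _) ((hNP p' hp').1 _) (hd _) (hd _)
    refine (Finset.sum_le_sum this).trans (le_of_eq ?_)
    simp
    ring

/-- The quadratic form acting on each column `j` of a matrix through the kernel `q j`. -/
def columnForm {d1 d2 : ℕ} (q : Fin d2 → Fin d1 → Fin d1 → ℝ) (H : Matrix (Fin d1) (Fin d2) ℝ) : ℝ :=
  ∑ j, ∑ i, ∑ i', q j i i' * (H i j * H i' j)

lemma abs_columnForm_sub_le {d1 d2 k : ℕ} {q : Fin d2 → Fin d1 → Fin d1 → ℝ} {Δ η : ℝ}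
    (hq : ∀ j i i', |q j i i'| ≤ Δ) (hΔ : 0 ≤ Δ)
    {H H' : Matrix (Fin d1) (Fin d2) ℝ} (hH : H ∈ boundedLowRank d1 d2 k)
    (hH' : H' ∈ boundedLowRank d1 d2 k) (hd : ∀ i j, |H i j - H' i j| ≤ η) :
    |columnForm q H - columnForm q H'| ≤ d2 * (d1 * (d1 * (Δ * (2 * η)))) := by
  have key : ∀ j i i', |q j i i' * (H i j * H i' j) - q j i i' * (H' i j * H' i' j)| ≤
      Δ * (2 * η) := fun j i i' => by
    rw [← mul_sub, abs_mul]
    exact mul_le_mul (hq j i i') (abs_mul_sub_mul_le (abs_entry_le_of_mem_boundedLowRank hH _ _)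
      (abs_entry_le_of_mem_boundedLowRank hH' _ _) (hd _ _) (hd _ _)) (abs_nonneg _) hΔ
  simp only [columnForm, ← Finset.sum_sub_distrib]
  calc _ ≤ ∑ j : Fin d2, ∑ i : Fin d1, ∑ i' : Fin d1,
        |q j i i' * (H i j * H i' j) - q j i i' * (H' i j * H' i' j)| := by
        refine (Finset.abs_sum_le_sum_abs _ _).trans (Finset.sum_le_sum fun j _ => ?_)
        refine (Finset.abs_sum_le_sum_abs _ _).trans (Finset.sum_le_sum fun i _ => ?_)
        exact Finset.abs_sum_le_sum_abs _ _
    _ ≤ ∑ _j : Fin d2, ∑ _i : Fin d1, ∑ _i' : Fin d1, Δ * (2 * η) :=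
        Finset.sum_le_sum fun j _ => Finset.sum_le_sum fun i _ => Finset.sum_le_sum fun i' _ =>
          key j i i'
    _ = _ := by simp

lemma exists_boundedLowRank_polarization {d1 d2 k : ℕ} (hk : 0 < k)
    {q : Fin d2 → Fin d1 → Fin d1 → ℝ} (hq : ∀ j i i', q j i i' = q j i' i)
    (j : Fin d2) (i i' : Fin d1) :
    ∃ E ∈ boundedLowRank d1 d2 k, ∃ E' ∈ boundedLowRank d1 d2 k,
      q j i i' = columnForm q E - columnForm q E' := by
  classical
  let v : ℝ → Fin d1 → ℝ := fun σ a =>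
    ((Pi.single i 1 : Fin d1 → ℝ) a + σ * (Pi.single i' 1 : Fin d1 → ℝ) a) / 2
  let E : ℝ → Matrix (Fin d1) (Fin d2) ℝ := fun σ a b => v σ a * (Pi.single j 1 : Fin d2 → ℝ) b
  have hs : ∀ (i a : Fin d1), (0 : ℝ) ≤ (Pi.single i 1 : Fin d1 → ℝ) a ∧
      (Pi.single i 1 : Fin d1 → ℝ) a ≤ 1 := by
    intro i a
    by_cases h : a = i
    · subst h; simp
    · simp [Pi.single_eq_of_ne h]
  have hs2 : ∀ (b : Fin d2), (0 : ℝ) ≤ (Pi.single j 1 : Fin d2 → ℝ) b ∧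
      (Pi.single j 1 : Fin d2 → ℝ) b ≤ 1 := by
    intro b
    by_cases h : b = j
    · subst h; simp
    · simp [Pi.single_eq_of_ne h]
  have hE : ∀ σ, σ ^ 2 = 1 → E σ ∈ boundedLowRank d1 d2 k := by
    intro σ hσ
    have hσ1 : |σ| ≤ 1 := by rw [← sq_le_one_iff_abs_le_one]; exact hσ.le
    refine ⟨⟨fun a c => if c = ⟨0, hk⟩ then v σ a else 0,
      fun b c => if c = ⟨0, hk⟩ then (Pi.single j 1 : Fin d2 → ℝ) b else 0, fun a c => ?_, fun b c => ?_,
      fun a b => ?_⟩, fun b => ?_⟩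
    · dsimp only
      split_ifs
      · obtain ⟨h1, h2⟩ := hs i a
        obtain ⟨h3, h4⟩ := hs i' a
        simp only [v]
        have h5 := abs_le.1 hσ1
        rw [abs_le]
        constructor <;> nlinarith
      · simp
    · dsimp only
      split_ifs
      · rw [abs_le]; constructor <;> linarith [(hs2 b).1, (hs2 b).2]
      · simp
    · simp [E]
    · have h1 : ∀ a, E σ a b ^ 2 ≤ ((Pi.single i 1 : Fin d1 → ℝ) a + (Pi.single i' 1 : Fin d1 → ℝ) a) / 2 := by
        intro a
        obtain ⟨h1, h2⟩ := hs i a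
        obtain ⟨h3, h4⟩ := hs i' a
        have h6 : (Pi.single j 1 : Fin d2 → ℝ) b ^ 2 ≤ 1 := by
          have := hs2 b
          nlinarith
        have h7 : v σ a ^ 2 ≤ ((Pi.single i 1 : Fin d1 → ℝ) a + (Pi.single i' 1 : Fin d1 → ℝ) a) / 2 := by
          simp only [v]
          set x := (Pi.single i 1 : Fin d1 → ℝ) a
          set y := (Pi.single i' 1 : Fin d1 → ℝ) a
          have : ((x + σ * y) / 2) ^ 2 ≤ (x ^ 2 + σ ^ 2 * y ^ 2) / 2 := by
            nlinarith [sq_nonneg (x - σ * y)]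
          rw [hσ] at this
          nlinarith
        simp only [E, mul_pow]
        nlinarith [sq_nonneg (v σ a), sq_nonneg ((Pi.single j 1 : Fin d2 → ℝ) b)]
      refine (Finset.sum_le_sum fun a _ => h1 a).trans (le_of_eq ?_)
      rw [← Finset.sum_div, Finset.sum_add_distrib]
      simp
  have hform : ∀ σ, columnForm q (E σ) = ∑ a, ∑ b, q j a b * (v σ a * v σ b) := by
    intro σ
    rw [columnForm, Finset.sum_eq_single j]
    · simp [E]
    · intro b _ hb
      simp [E, Pi.single_eq_of_ne hb]
    · simp
  refine ⟨E 1, hE 1 (by norm_num), E (-1), hE (-1) (by norm_num), ?_⟩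
  rw [hform, hform, ← Finset.sum_sub_distrib]
  simp_rw [← Finset.sum_sub_distrib]
  have : ∀ a b, q j a b * (v 1 a * v 1 b) - q j a b * (v (-1) a * v (-1) b) =
      (q j a b * ((Pi.single i 1 : Fin d1 → ℝ) a * (Pi.single i' 1 : Fin d1 → ℝ) b) +
        q j a b * ((Pi.single i' 1 : Fin d1 → ℝ) a * (Pi.single i 1 : Fin d1 → ℝ) b)) / 2 := by
    intro a b
    simp only [v]
    ring
  simp_rw [this, ← Finset.sum_div, Finset.sum_add_distrib]
  have single_sum : ∀ x y : Fin d1, ∑ a, ∑ b, q j a b * ((Pi.single x 1 : Fin d1 → ℝ) a *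
      (Pi.single y 1 : Fin d1 → ℝ) b) = q j x y := by
    intro x y
    simp [Pi.single_apply]
  rw [single_sum, single_sum, hq j i' i]
  ring

/-- A net on which control of column-wise quadratic forms transfers to all of
`boundedLowRank d1 d2 k`. -/
lemma exists_finset_norming {d1 d2 k : ℕ} (hd1 : 0 < d1) (hd2 : 0 < d2) (hk : 0 < k)
    (hk1 : k ≤ d1 + d2) :
    ∃ N : Finset (Matrix (Fin d1) (Fin d2) ℝ), (∀ H ∈ N, H ∈ boundedLowRank d1 d2 k) ∧
      N.card ≤ (33 * (d1 + d2) ^ 4) ^ ((d1 + d2) * k) ∧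
      ∀ q : Fin d2 → Fin d1 → Fin d1 → ℝ, (∀ j i i', q j i i' = q j i' i) →
        ∀ u : ℝ, (∀ H ∈ N, |columnForm q H| ≤ u) →
          ∀ H ∈ boundedLowRank d1 d2 k, |columnForm q H| ≤ 2 * u := by
  have hpos : 0 < (d1 + d2) ^ 4 := by positivity
  obtain ⟨N, hNT, hcard, hN⟩ := exists_finset_net_boundedLowRank d1 d2 k
    (m := 16 * (d1 + d2) ^ 4) (by positivity)
  refine ⟨N, hNT, hcard.trans (Nat.pow_le_pow_left (by omega) _), ?_⟩
  intro q hq u hu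
  let s : Finset (Fin d2 × Fin d1 × Fin d1) := Finset.univ
  have hs : s.Nonempty := ⟨(⟨0, hd2⟩, ⟨0, hd1⟩, ⟨0, hd1⟩), Finset.mem_univ _⟩
  obtain ⟨x, -, hx⟩ := Finset.exists_max_image s (fun x => |q x.1 x.2.1 x.2.2|) hs
  set Δ := |q x.1 x.2.1 x.2.2| with hΔ
  have hΔ0 : 0 ≤ Δ := abs_nonneg _
  have hqΔ : ∀ j i i', |q j i i'| ≤ Δ := fun j i i' => hx (j, i, i') (Finset.mem_univ _)
  have hmain : ∀ H ∈ boundedLowRank d1 d2 k, |columnForm q H| ≤ u + Δ / 4 := by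
    intro H hH
    obtain ⟨H', hH', hd⟩ := hN H hH
    have h1 := abs_columnForm_sub_le hqΔ hΔ0 hH (hNT H' hH') hd
    have h2 : (d2 : ℝ) * (d1 * (d1 * (Δ * (2 * (2 * k / (16 * (d1 + d2) ^ 4 : ℕ)))))) ≤ Δ / 4 := by
      push_cast
      set n : ℝ := (d1 : ℝ) + d2 with hn
      have a1 : (0 : ℝ) < d1 := by exact_mod_cast hd1
      have a2 : (0 : ℝ) < d2 := by exact_mod_cast hd2
      have hn0 : 0 < n := by positivity
      have a3 : (k : ℝ) ≤ n := by rw [hn]; exact_mod_cast hk1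
      have e : (d2 : ℝ) * (d1 * (d1 * (Δ * (2 * (2 * k / (16 * n ^ 4)))))) =
          (Δ / 4) * ((d2 * d1 * d1 * k) / n ^ 4) := by field_simp; ring
      rw [e]
      refine mul_le_of_le_one_right (by positivity) ?_
      rw [div_le_one (by positivity)]
      calc (d2 : ℝ) * d1 * d1 * k ≤ n * n * n * n := by gcongr <;> linarith
        _ = n ^ 4 := by ring
    have h3 := hu H' hH'
    have h4 := abs_sub_abs_le_abs_sub (columnForm q H) (columnForm q H')
    linarith
  have hΔu : Δ ≤ 4 * u := by
    obtain ⟨E, hE, E', hE', he⟩ := exists_boundedLowRank_polarization hk hq x.1 x.2.1 x.2.2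
    have h1 := hmain E hE
    have h2 := hmain E' hE'
    have h3 : Δ ≤ |columnForm q E| + |columnForm q E'| := by
      rw [hΔ, he]; exact abs_sub _ _
    linarith
  intro H hH
  have := hmain H hH
  linarith

/-- The centred empirical quadratic form `∑ₖ ((βₖ ⬝ H e_{jₖ})² - ‖H e_{jₖ}‖²)`. -/
def deviationForm {n d1 d2 : ℕ} (j : Fin n → Fin d2) (β : Fin n → Fin d1 → ℝ)
    (H : Matrix (Fin d1) (Fin d2) ℝ) : ℝ :=
  ∑ k, ((∑ i, β k i * H i (j k)) ^ 2 - ∑ i, H i (j k) ^ 2)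

lemma exists_deviationForm_eq_columnForm {n d1 d2 : ℕ} (j : Fin n → Fin d2)
    (β : Fin n → Fin d1 → ℝ) :
    ∃ q : Fin d2 → Fin d1 → Fin d1 → ℝ, (∀ b i i', q b i i' = q b i' i) ∧
      ∀ H, deviationForm j β H = columnForm q H := by
  refine ⟨fun b i i' => ∑ k, if j k = b then β k i * β k i' - (if i = i' then 1 else 0) else 0,
    fun b i i' => ?_, fun H => ?_⟩
  · refine Finset.sum_congr rfl fun k _ => ?_
    rw [mul_comm]
    simp only [eq_comm (a := i)]
  · have hk : ∀ k, (∑ i, β k i * H i (j k)) ^ 2 - ∑ i, H i (j k) ^ 2 =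
        ∑ i, ∑ i', (β k i * β k i' - (if i = i' then 1 else 0)) * (H i (j k) * H i' (j k)) := by
      intro k
      simp only [sub_mul, Finset.sum_sub_distrib]
      congr 1
      · rw [sq, Finset.sum_mul_sum]
        refine Finset.sum_congr rfl fun i _ => Finset.sum_congr rfl fun i' _ => by ring
      · refine Finset.sum_congr rfl fun i _ => ?_
        simp [sq]
    simp only [deviationForm, columnForm, hk, Finset.sum_mul]
    symm
    calc _ = ∑ b, ∑ k, ∑ i, ∑ i', (if j k = b then
            β k i * β k i' - (if i = i' then 1 else 0) else 0) * (H i b * H i' b) := by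
          refine Finset.sum_congr rfl fun b _ => ?_
          rw [Finset.sum_comm]
          simp_rw [Finset.sum_comm (s := (Finset.univ : Finset (Fin n)))]
          rw [Finset.sum_comm]
      _ = _ := by
          rw [Finset.sum_comm]
          refine Finset.sum_congr rfl fun k _ => ?_
          rw [Finset.sum_eq_single (j k)]
          · simp
          · intro b _ hb
            simp [Ne.symm hb]
          · simp

lemma card_grid_le_exp {N e : ℕ} (hN : 2 ≤ N) :
    (((33 * N ^ 4) ^ e : ℕ) : ℝ) ≤ Real.exp (10 * e * Real.log N) := by
  have hN' : (2 : ℝ) ≤ N := by exact_mod_cast hN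
  have h0 : (0 : ℝ) < N := by linarith
  have h1 : (33 : ℝ) * N ^ 4 ≤ N ^ 10 := by
    have : (2 : ℝ) ^ 6 ≤ (N : ℝ) ^ 6 := by gcongr
    have h4 : (0 : ℝ) < (N : ℝ) ^ 4 := by positivity
    calc (33 : ℝ) * (N : ℝ) ^ 4 ≤ (N : ℝ) ^ 6 * (N : ℝ) ^ 4 := by
          gcongr
          linarith
      _ = (N : ℝ) ^ 10 := by ring
  have h2 : Real.exp (10 * e * Real.log N) = ((N : ℝ) ^ 10) ^ e := by
    rw [← pow_mul, ← Real.exp_log (pow_pos h0 (10 * e)), Real.log_pow]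
    push_cast
    rfl
  rw [h2]
  push_cast
  gcongr

/-- With probability at least `1 - ζ`, the deviation form is small simultaneously on all
bounded low-rank classes. -/
lemma exists_uniform_event {d1 d2 n : ℕ} (hd1 : 0 < d1) (hd2 : 0 < d2) (hn : 0 < n)
    (j : Fin n → Fin d2) {ζ : ℝ} (hζ : ζ ∈ Set.Ioo (0 : ℝ) 1) :
    ∃ Good : Set (Fin n → Fin d1 → ℝ), MeasurableSet Good ∧
      (1 : ℝ≥0∞) - ENNReal.ofReal ζ ≤
        Measure.pi (fun _ : Fin n => Measure.pi (fun _ : Fin d1 => gaussianReal 0 1)) Good ∧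
      ∀ β ∈ Good, ∀ k, 0 < k → k ≤ d1 → ∀ H ∈ boundedLowRank d1 d2 k, ∀ τ : ℝ,
        τ = (12 * k * (d1 + d2) * Real.log (d1 + d2) + Real.log (2 / ζ)) / n →
        |deviationForm j β H| ≤ 16 * n * max τ (√τ) := by
  classical
  set μ := Measure.pi (fun _ : Fin n => Measure.pi (fun _ : Fin d1 => gaussianReal 0 1))
  have hnR : (0 : ℝ) < n := by exact_mod_cast hn
  have hNR : (2 : ℝ) ≤ (d1 : ℝ) + d2 := by
    have : 2 ≤ d1 + d2 := by omega
    exact_mod_cast this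
  have hlog : 0 ≤ Real.log ((d1 : ℝ) + d2) := Real.log_nonneg (by linarith)
  have hz : 0 ≤ Real.log (2 / ζ) := Real.log_nonneg (by
    rw [le_div_iff₀ hζ.1]; linarith [hζ.2])
  let τ : ℕ → ℝ := fun k => (12 * k * (d1 + d2) * Real.log (d1 + d2) + Real.log (2 / ζ)) / n
  have hτ : ∀ k, 0 ≤ τ k := fun k => by positivity
  have hnet : ∀ k : ℕ, ∃ N : Finset (Matrix (Fin d1) (Fin d2) ℝ), 0 < k → k ≤ d1 →
      ((∀ H ∈ N, H ∈ boundedLowRank d1 d2 k) ∧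
      N.card ≤ (33 * (d1 + d2) ^ 4) ^ ((d1 + d2) * k) ∧
      ∀ q : Fin d2 → Fin d1 → Fin d1 → ℝ, (∀ j i i', q j i i' = q j i' i) →
        ∀ u : ℝ, (∀ H ∈ N, |columnForm q H| ≤ u) →
          ∀ H ∈ boundedLowRank d1 d2 k, |columnForm q H| ≤ 2 * u) := by
    intro k
    by_cases hk : 0 < k ∧ k ≤ d1
    · obtain ⟨N, hN⟩ := exists_finset_norming (d2 := d2) hd1 hd2 hk.1 (by omega)
      exact ⟨N, fun _ _ => hN⟩
    · exact ⟨∅, fun h1 h2 => absurd ⟨h1, h2⟩ hk⟩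
  choose net hnet using hnet
  let bad : ℕ → Matrix (Fin d1) (Fin d2) ℝ → Set (Fin n → Fin d1 → ℝ) := fun k H =>
    {β | 8 * n * max (τ k) (√(τ k)) ≤ |deviationForm j β H|}
  have hbad_meas : ∀ k H, MeasurableSet (bad k H) := fun k H => by
    refine measurableSet_le measurable_const ?_
    unfold deviationForm
    fun_prop
  let Bad : Set (Fin n → Fin d1 → ℝ) := ⋃ k ∈ Finset.Icc 1 d1, ⋃ H ∈ net k, bad k H
  have hBad_meas : MeasurableSet Bad :=
    Finset.measurableSet_biUnion _ fun k _ => Finset.measurableSet_biUnion _ fun H _ =>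
      hbad_meas k H
  have hbad_le : ∀ k ∈ Finset.Icc 1 d1, μ.real (⋃ H ∈ net k, bad k H) ≤ ζ * (1 / (d1 + d2)) := by
    intro k hk
    obtain ⟨hk1, hk2⟩ := Finset.mem_Icc.1 hk
    obtain ⟨hNT, hcard, -⟩ := hnet k hk1 hk2
    have hk1' : (1 : ℝ) ≤ k := by exact_mod_cast hk1
    calc μ.real (⋃ H ∈ net k, bad k H) ≤ ∑ H ∈ net k, μ.real (bad k H) :=
          measureReal_biUnion_finset_le _ _
      _ ≤ ∑ _H ∈ net k, 2 * Real.exp (-(n * τ k)) := by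
          refine Finset.sum_le_sum fun H hH => ?_
          exact gaussian_square_tail (fun k i => H i (j k)) (fun k => (hNT H hH).2 (j k)) (hτ k)
      _ = (net k).card * (2 * Real.exp (-(n * τ k))) := by simp
      _ ≤ Real.exp (10 * ((d1 + d2) * k : ℕ) * Real.log (d1 + d2 : ℕ)) *
            (2 * Real.exp (-(n * τ k))) := by
          gcongr
          refine le_trans ?_ (card_grid_le_exp (by omega))
          exact_mod_cast hcard
      _ = ζ * Real.exp (-(2 * ((d1 + d2) * k)) * Real.log (d1 + d2)) := by
          have e1 : (n : ℝ) * τ k =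
              12 * k * (d1 + d2) * Real.log (d1 + d2) + Real.log (2 / ζ) := by
            simp only [τ]; field_simp
          have e2 : ζ = 2 * Real.exp (- Real.log (2 / ζ)) := by
            rw [Real.exp_neg, Real.exp_log (div_pos two_pos hζ.1)]
            have := hζ.1.ne'
            field_simp
          rw [e1]
          conv_rhs => rw [e2]
          rw [mul_left_comm, ← Real.exp_add, mul_assoc 2, ← Real.exp_add]
          push_cast
          ring_nf
      _ ≤ ζ * (1 / (d1 + d2)) := by
          refine mul_le_mul_of_nonneg_left ?_ hζ.1.le
          rw [one_div, ← Real.exp_log (show (0 : ℝ) < ((d1 : ℝ) + d2)⁻¹ by positivity), Real.log_inv]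
          refine Real.exp_le_exp.2 ?_
          have : (1 : ℝ) ≤ 2 * ((d1 + d2) * k) := by nlinarith
          nlinarith
  have hBad : μ.real Bad ≤ ζ := by
    calc μ.real Bad ≤ ∑ k ∈ Finset.Icc 1 d1, μ.real (⋃ H ∈ net k, bad k H) :=
          measureReal_biUnion_finset_le _ _
      _ ≤ ∑ _k ∈ Finset.Icc 1 d1, ζ * (1 / (d1 + d2)) := Finset.sum_le_sum hbad_le
      _ = ζ * (d1 / (d1 + d2)) := by simp; ring
      _ ≤ ζ := by
          refine mul_le_of_le_one_right hζ.1.le ?_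
          rw [div_le_one (by linarith)]
          linarith [(Nat.cast_nonneg d2 : (0 : ℝ) ≤ d2)]
  refine ⟨Badᶜ, hBad_meas.compl, ?_, ?_⟩
  · rw [prob_compl_eq_one_sub hBad_meas]
    refine tsub_le_tsub_left ?_ 1
    rw [← ofReal_measureReal (measure_ne_top μ Bad)]
    exact ENNReal.ofReal_le_ofReal hBad
  · rintro β hβ k hk1 hk2 H hH t rfl
    obtain ⟨q, hqs, hq⟩ := exists_deviationForm_eq_columnForm j β
    have := (hnet k hk1 hk2).2.2 q hqs (8 * n * max (τ k) (√(τ k))) (fun H' hH' => ?_) H hH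
    · rw [hq]
      refine this.trans (le_of_eq ?_)
      simp only [τ]
      ring
    · rw [← hq]
      by_contra hcon
      push Not at hcon
      exact hβ (mem_iUnion₂.2 ⟨k, Finset.mem_Icc.2 ⟨hk1, hk2⟩, mem_iUnion₂.2 ⟨H', hH', hcon.le⟩⟩)

lemma sum_sq_col_le_norm12_sq {m n : ℕ} (M : Matrix (Fin m) (Fin n) ℝ) (j : Fin n) :
    ∑ i, M i j ^ 2 ≤ norm12 M ^ 2 := by
  have h := le_ciSup (f := fun j => √(∑ i, M i j ^ 2)) (Set.finite_range _).bddAbove j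
  have h0 : 0 ≤ ∑ i, M i j ^ 2 := Finset.sum_nonneg fun i _ => sq_nonneg _
  calc ∑ i, M i j ^ 2 = √(∑ i, M i j ^ 2) ^ 2 := (Real.sq_sqrt h0).symm
    _ ≤ norm12 M ^ 2 := pow_le_pow_left₀ (Real.sqrt_nonneg _) h 2

lemma norm12_nonneg {m n : ℕ} (M : Matrix (Fin m) (Fin n) ℝ) : 0 ≤ norm12 M :=
  Real.iSup_nonneg fun _ => Real.sqrt_nonneg _

lemma frobNorm_sq {m n : ℕ} (M : Matrix (Fin m) (Fin n) ℝ) :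
    frobNorm M ^ 2 = ∑ i, ∑ j, M i j ^ 2 :=
  Real.sq_sqrt (Finset.sum_nonneg fun _ _ => Finset.sum_nonneg fun _ _ => sq_nonneg _)

lemma exists_factorization_lt {d1 d2 : ℕ} {M : Matrix (Fin d1) (Fin d2) ℝ} {c : ℝ}
    (h : mixedNorm M < c) :
    ∃ (d : ℕ) (U : Matrix (Fin d1) (Fin d) ℝ) (V : Matrix (Fin d2) (Fin d) ℝ),
      M = U * Vᵀ ∧ frobNorm U * norm12 Vᵀ < c := by
  obtain ⟨_, ⟨d, U, V, hM, rfl⟩, hc⟩ := exists_lt_of_csInf_lt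
    (s := {c | ∃ (d : ℕ) (U : Matrix (Fin d1) (Fin d) ℝ) (V : Matrix (Fin d2) (Fin d) ℝ),
      M = U * Vᵀ ∧ c = frobNorm U * norm12 Vᵀ}) ⟨_, d2, M, 1, by simp, rfl⟩ h
  exact ⟨d, U, V, hM, hc⟩

/-- An orthonormal diagonalization of `U * Uᵀ`. -/
lemma exists_orthogonal_diagonalization {d1 d : ℕ} (U : Matrix (Fin d1) (Fin d) ℝ) :
    ∃ (W : Matrix (Fin d1) (Fin d1) ℝ) (lam : Fin d1 → ℝ), Wᵀ * W = 1 ∧ W * Wᵀ = 1 ∧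
      (∀ a, 0 ≤ lam a) ∧ ∑ a, lam a = ∑ i, ∑ j, U i j ^ 2 ∧
      Wᵀ * (U * Uᵀ) * W = diagonal lam := by
  have hps : (U * Uᵀ).PosSemidef := by
    simpa using Matrix.posSemidef_self_mul_conjTranspose U
  have hH := hps.isHermitian
  let W : Matrix (Fin d1) (Fin d1) ℝ := hH.eigenvectorUnitary
  have hWs : star W = Wᵀ := by
    rw [star_eq_conjTranspose, conjTranspose_eq_transpose_of_trivial]
  have h1 : Wᵀ * W = 1 := by rw [← hWs]; exact Unitary.coe_star_mul_self _
  have h2 : W * Wᵀ = 1 := by rw [← hWs]; exact Unitary.coe_mul_star_self _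
  have hsp : U * Uᵀ = W * diagonal hH.eigenvalues * Wᵀ := by
    have := hH.spectral_theorem
    rw [Unitary.conjStarAlgAut_apply] at this
    rw [← hWs]
    exact this
  refine ⟨W, hH.eigenvalues, h1, h2, hps.eigenvalues_nonneg, ?_, ?_⟩
  · have := hH.trace_eq_sum_eigenvalues
    simp only [RCLike.ofReal_real_eq_id, id] at this
    rw [← this]
    simp [Matrix.trace, Matrix.mul_apply, sq]
  · calc Wᵀ * (U * Uᵀ) * W
        = Wᵀ * (W * diagonal hH.eigenvalues * Wᵀ) * W := congrArg (fun A => Wᵀ * A * W) hsp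
      _ = (Wᵀ * W) * diagonal hH.eigenvalues * (Wᵀ * W) := by simp only [Matrix.mul_assoc]
      _ = _ := by rw [h1, Matrix.one_mul, Matrix.mul_one]

lemma sum_sq_mulVec_of_orthogonal {m n : ℕ} {W : Matrix (Fin m) (Fin n) ℝ} (hW : Wᵀ * W = 1)
    (x : Fin n → ℝ) : ∑ i, (W *ᵥ x) i ^ 2 = ∑ a, x a ^ 2 := by
  have h : (W *ᵥ x) ⬝ᵥ (W *ᵥ x) = x ⬝ᵥ x := by
    rw [dotProduct_mulVec, ← mulVec_transpose, mulVec_mulVec, hW, one_mulVec]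
  simpa [dotProduct, sq] using h

lemma exists_spectral_coordinates {d1 d2 r : ℕ} (hr : 0 < r)
    {M : Matrix (Fin d1) (Fin d2) ℝ} (hM : tripleNorm r M ≤ 1) :
    ∃ (W : Matrix (Fin d1) (Fin d1) ℝ) (x : Matrix (Fin d1) (Fin d2) ℝ) (lam : Fin d1 → ℝ),
      Wᵀ * W = 1 ∧ M = W * x ∧ (∀ a, 0 ≤ lam a) ∧ ∑ a, lam a ≤ 4 * r ∧
      (∀ j, ∑ a, x a j ^ 2 ≤ 1) ∧
      ∀ (I : Finset (Fin d1)) (ε : ℝ), 0 ≤ ε → (∀ a ∉ I, lam a ≤ ε) →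
        ∀ j, ∑ a ∈ Iᶜ, x a j ^ 2 ≤ ε := by
  classical
  have hr' : (0 : ℝ) < √r := Real.sqrt_pos.2 (by exact_mod_cast hr)
  obtain ⟨hM1, hM2⟩ := max_le_iff.1 hM
  rw [div_le_one hr'] at hM2
  obtain ⟨d, U, V, hUV, hlt⟩ := exists_factorization_lt (M := M) (c := 2 * √r) (by linarith)
  obtain ⟨W, lam, h1, h2, hlam, hsum, hdiag⟩ := exists_orthogonal_diagonalization U
  set ν := norm12 Vᵀ
  have hν : 0 ≤ ν := norm12_nonneg _
  have hMx : M = W * (Wᵀ * M) := by rw [← Matrix.mul_assoc, h2, Matrix.one_mul]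
  refine ⟨W, Wᵀ * M, fun a => lam a * ν ^ 2, h1, hMx, fun a => mul_nonneg (hlam a) (sq_nonneg _),
    ?_, ?_, ?_⟩
  · rw [← Finset.sum_mul, hsum, ← frobNorm_sq, ← mul_pow]
    have h0 : 0 ≤ frobNorm U * ν := mul_nonneg (Real.sqrt_nonneg _) hν
    calc (frobNorm U * ν) ^ 2 ≤ (2 * √r) ^ 2 := pow_le_pow_left₀ h0 hlt.le 2
      _ = 4 * r := by rw [mul_pow, Real.sq_sqrt (Nat.cast_nonneg r)]; norm_num
  · intro j
    have h := sum_sq_mulVec_of_orthogonal h1 (fun a => (Wᵀ * M) a j)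
    have e : W *ᵥ (fun a => (Wᵀ * M) a j) = fun i => M i j := by
      ext i
      conv_rhs => rw [hMx]
      simp [Matrix.mul_apply, mulVec, dotProduct]
    rw [e] at h
    rw [← h]
    have h3 := sum_sq_col_le_norm12_sq M j
    have h4 := norm12_nonneg M
    nlinarith
  · intro I ε hε hI j
    set x := Wᵀ * M with hx
    let y : Fin d1 → ℝ := fun a => if a ∈ I then 0 else x a j
    let p : Fin d → ℝ := Uᵀ *ᵥ (W *ᵥ y)
    have hS : ∑ a ∈ Iᶜ, x a j ^ 2 = ∑ a, y a ^ 2 := by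
      rw [← Finset.sum_subset (Finset.subset_univ Iᶜ)]
      · refine Finset.sum_congr rfl fun a ha => ?_
        simp [y, Finset.mem_compl.1 ha]
      · intro a _ ha
        simp [y, (by simpa using ha : a ∈ I)]
    have hS2 : ∑ a, y a ^ 2 = ∑ b, p b * V j b := by
      have e1 : ∑ a, y a ^ 2 = y ⬝ᵥ (Wᵀ *ᵥ (U *ᵥ V j)) := by
        have : Wᵀ *ᵥ (U *ᵥ V j) = fun a => x a j := by
          ext a
          rw [hx, hUV, mulVec_mulVec, ← Matrix.mul_assoc]
          simp [Matrix.mul_apply, mulVec, dotProduct]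
        rw [this]
        refine Finset.sum_congr rfl fun a _ => ?_
        simp only [y]
        split_ifs <;> ring
      rw [e1, dotProduct_mulVec, ← mulVec_transpose, transpose_transpose, dotProduct_mulVec,
        ← mulVec_transpose]
      rfl
    have hp : ∑ b, p b ^ 2 = ∑ a, lam a * y a ^ 2 := by
      have e : p ⬝ᵥ p = y ⬝ᵥ ((Wᵀ * (U * Uᵀ) * W) *ᵥ y) := by
        simp only [p]
        rw [dotProduct_mulVec, ← mulVec_transpose, transpose_transpose, dotProduct_mulVec,
          ← mulVec_transpose, dotProduct_comm]
        simp only [mulVec_mulVec, Matrix.mul_assoc]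
      rw [hdiag] at e
      simp only [dotProduct, mulVec_diagonal] at e
      calc ∑ b, p b ^ 2 = ∑ b, p b * p b := by simp only [sq]
        _ = _ := by rw [e]; exact Finset.sum_congr rfl fun a _ => by ring
    have hV : ∑ b, V j b ^ 2 ≤ ν ^ 2 := sum_sq_col_le_norm12_sq Vᵀ j
    rw [hS]
    set S := ∑ a, y a ^ 2
    have hS0 : 0 ≤ S := Finset.sum_nonneg fun a _ => sq_nonneg _
    have hcs := Finset.sum_mul_sq_le_sq_mul_sq Finset.univ p (V j)
    rw [← hS2, hp] at hcs
    have hlamS : (∑ a, lam a * y a ^ 2) * ν ^ 2 ≤ ε * S := by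
      rw [Finset.sum_mul, Finset.mul_sum]
      refine Finset.sum_le_sum fun a _ => ?_
      by_cases ha : a ∈ I
      · simp [y, ha]
      · have := mul_le_mul_of_nonneg_right (hI a ha) (sq_nonneg (y a))
        linarith
    have h0 : 0 ≤ ∑ a, lam a * y a ^ 2 :=
      Finset.sum_nonneg fun a _ => mul_nonneg (hlam a) (sq_nonneg _)
    have : S ^ 2 ≤ ε * S := hcs.trans ((mul_le_mul_of_nonneg_left hV h0).trans hlamS)
    by_contra hcon
    push Not at hcon
    nlinarith

lemma norm_sq_sub_norm_sq_eq_inner {Z : Type*} [NormedAddCommGroup Z] [InnerProductSpace ℝ Z]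
    (u v : Z) : ‖u‖ ^ 2 - ‖v‖ ^ 2 = inner ℝ (u + v) (u - v) := by
  rw [inner_add_left, inner_sub_right, inner_sub_right, real_inner_self_eq_norm_sq,
    real_inner_self_eq_norm_sq, real_inner_comm]
  ring

lemma inner_map_smul_smul {E Z : Type*} [AddCommGroup E] [Module ℝ E]
    [NormedAddCommGroup Z] [InnerProductSpace ℝ Z] (T : E →ₗ[ℝ] Z) {G H g h : E} {c d : ℝ}
    (hH : H = c • h) (hG : G = d • g) :
    inner ℝ (T H) (T G) =
      c * d * (‖T ((1 / 2 : ℝ) • (h + g))‖ ^ 2 - ‖T ((1 / 2 : ℝ) • (h - g))‖ ^ 2) := by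
  rw [norm_sq_sub_norm_sq_eq_inner, ← map_add, ← map_sub, ← smul_add, ← smul_sub, hG, hH,
    show (h + g + (h - g)) = (2 : ℝ) • h by module,
    show (h + g - (h - g)) = (2 : ℝ) • g by module]
  simp only [map_smul, inner_smul_left, inner_smul_right, conj_trivial]
  ring

set_option maxHeartbeats 1000000 in
/-- Chaining for the difference of two quadratic forms: if the deviation
`‖Φ F‖² - ‖Ψ F‖²` is small on each of the convex sets `B s`, it is small at the end of a chain
whose `s`-th increment lies in a multiple of order `2⁻ˢ` of `B s`. -/
lemma abs_deviation_chain_le {E X Y : Type*} [AddCommGroup E] [Module ℝ E]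
    [NormedAddCommGroup X] [InnerProductSpace ℝ X] [NormedAddCommGroup Y] [InnerProductSpace ℝ Y]
    (Φ : E →ₗ[ℝ] X) (Ψ : E →ₗ[ℝ] Y) (A : ℕ → E) (hA : A 0 = 0) (S : ℕ) (B : ℕ → Set E)
    {n p y : ℝ} (hn : 0 ≤ n) (hp : 0 ≤ p) (hy : 0 ≤ y)
    (hΨ : ∀ s ≤ S, ∀ F ∈ B s, ‖Ψ F‖ ≤ √n)
    (hD : ∀ s ≤ S, ∀ F ∈ B s, |‖Φ F‖ ^ 2 - ‖Ψ F‖ ^ 2| ≤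
      16 * n * ((2 ^ s * p + y) + (2 ^ s * p + y) ^ 2))
    (hchain : ∀ s ≤ S, ∃ g h : E, A (s + 1) - A s = (2 * (1 / 2 : ℝ) ^ s) • g ∧
      A (s + 1) + A s = (2 : ℝ) • h ∧ g ∈ B s ∧ h ∈ B s ∧
      (1 / 2 : ℝ) • (h + g) ∈ B s ∧ (1 / 2 : ℝ) • (h - g) ∈ B s) :
    |‖Φ (A (S + 1))‖ ^ 2 - ‖Ψ (A (S + 1))‖ ^ 2| ≤
      1560 * n * (((S + 1) * p + y) + ((S + 1) * p + y) ^ 2) := by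
  choose! g h hg hh hgB hhB hpB hmB using hchain
  have hsn : √n * √n = n := Real.mul_self_sqrt hn
  have hsn0 : 0 ≤ √n := Real.sqrt_nonneg n
  have he0 : ∀ s : ℕ, (0 : ℝ) < (1 / 2) ^ s := fun s => by positivity
  have he1 : ∀ s : ℕ, (1 / 2 : ℝ) ^ s * 2 ^ s = 1 := fun s => by rw [← mul_pow]; norm_num
  have hΦg : ∀ s ≤ S, ‖Φ (A (s + 1) - A s)‖ ≤
      8 * √n * ((1 / 2) ^ s + p + (1 / 2) ^ s * y) := by
    intro s hs
    have h1 := (abs_le.1 (hD s hs _ (hgB s hs))).2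
    have h2 := hΨ s hs _ (hgB s hs)
    set ρ := 2 ^ s * p + y with hρ
    have hρ0 : 0 ≤ ρ := by positivity
    have h3 : ‖Φ (g s)‖ ≤ 4 * √n * (1 + ρ) := by
      refine (sq_le_sq₀ (norm_nonneg _) (by positivity)).1 ?_
      have h4 : ‖Ψ (g s)‖ ^ 2 ≤ n := by nlinarith [norm_nonneg (Ψ (g s))]
      have h5 : (4 * √n * (1 + ρ)) ^ 2 = 16 * n * (1 + ρ) ^ 2 := by
        linear_combination 16 * (1 + ρ) ^ 2 * hsn
      rw [h5]
      nlinarith [mul_nonneg hn hρ0]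
    rw [hg s hs, map_smul, norm_smul, Real.norm_of_nonneg (by positivity)]
    calc 2 * (1 / 2) ^ s * ‖Φ (g s)‖ ≤ 2 * (1 / 2) ^ s * (4 * √n * (1 + ρ)) := by gcongr
      _ = _ := by rw [hρ]; linear_combination 8 * √n * p * he1 s
  set R := 2 + (S + 1) * p + 2 * y with hR
  have hΦA : ∀ s ≤ S + 1, ‖Φ (A s)‖ ≤ 8 * √n * R := by
    intro s hs
    have h1 : A s = ∑ i ∈ Finset.range s, (A (i + 1) - A i) := by
      rw [Finset.sum_range_sub, hA, sub_zero]
    have hs' : (s : ℝ) ≤ S + 1 := by exact_mod_cast hs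
    calc ‖Φ (A s)‖ ≤ ∑ i ∈ Finset.range s, ‖Φ (A (i + 1) - A i)‖ := by
          conv_lhs => rw [h1, map_sum]
          exact norm_sum_le _ _
      _ ≤ ∑ i ∈ Finset.range s, 8 * √n * ((1 / 2) ^ i + p + (1 / 2) ^ i * y) :=
          Finset.sum_le_sum fun i hi => hΦg i (by have := Finset.mem_range.1 hi; omega)
      _ = 8 * √n * ((∑ i ∈ Finset.range s, (1 / 2 : ℝ) ^ i) + s * p +
            (∑ i ∈ Finset.range s, (1 / 2 : ℝ) ^ i) * y) := by
          rw [← Finset.mul_sum, Finset.sum_add_distrib, Finset.sum_add_distrib, Finset.sum_mul]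
          simp
      _ ≤ 8 * √n * R := by
          rw [hR]
          have := sum_geometric_two_le s
          gcongr
  have hR2 : 2 ≤ R := by rw [hR]; nlinarith [mul_nonneg (by positivity : (0 : ℝ) ≤ S + 1) hp]
  have hRy : 2 * y ≤ R := by rw [hR]; nlinarith [mul_nonneg (by positivity : (0 : ℝ) ≤ S + 1) hp]
  have hstep : ∀ s ≤ S, |(‖Φ (A (s + 1))‖ ^ 2 - ‖Ψ (A (s + 1))‖ ^ 2) -
      (‖Φ (A s)‖ ^ 2 - ‖Ψ (A s)‖ ^ 2)| ≤ 260 * n * R * (3 * p + (1 / 2) ^ s * y) := by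
    intro s hs
    have he := he0 s
    set e := (1 / 2 : ℝ) ^ s
    have key : (‖Φ (A (s + 1))‖ ^ 2 - ‖Ψ (A (s + 1))‖ ^ 2) - (‖Φ (A s)‖ ^ 2 - ‖Ψ (A s)‖ ^ 2) =
        inner ℝ (Φ (A (s + 1) + A s)) (Φ (A (s + 1) - A s)) -
        inner ℝ (Ψ (A (s + 1) + A s)) (Ψ (A (s + 1) - A s)) := by
      rw [map_add, map_sub, map_add, map_sub, ← norm_sq_sub_norm_sq_eq_inner,
        ← norm_sq_sub_norm_sq_eq_inner]
      ring
    have h2s : (0 : ℝ) ≤ 2 ^ s * p := by positivity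
    rw [key]
    rcases le_or_gt (2 ^ s * p) 1 with hc | hc
    · rw [inner_map_smul_smul Φ (hh s hs) (hg s hs), inner_map_smul_smul Ψ (hh s hs) (hg s hs),
        show (2 : ℝ) * (2 * e) = 4 * e by ring]
      have h1 := hD s hs _ (hpB s hs)
      have h2 := hD s hs _ (hmB s hs)
      set a := ‖Φ ((1 / 2 : ℝ) • (h s + g s))‖ ^ 2
      set b := ‖Φ ((1 / 2 : ℝ) • (h s - g s))‖ ^ 2
      set c := ‖Ψ ((1 / 2 : ℝ) • (h s + g s))‖ ^ 2
      set d := ‖Ψ ((1 / 2 : ℝ) • (h s - g s))‖ ^ 2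
      set ρ := 2 ^ s * p + y with hρ
      have h3 : |4 * e * (a - b) - 4 * e * (c - d)| ≤ 4 * e * (2 * (16 * n * (ρ + ρ ^ 2))) := by
        rw [show 4 * e * (a - b) - 4 * e * (c - d) = 4 * e * ((a - c) - (b - d)) by ring, abs_mul,
          abs_of_nonneg (by positivity : 0 ≤ 4 * e)]
        gcongr
        exact (abs_sub _ _).trans (by linarith)
      have h4 : ρ ^ 2 ≤ 2 * (2 ^ s * p) + 2 * y ^ 2 := by
        rw [hρ]
        nlinarith [sq_nonneg (2 ^ s * p - y)]
      have h5 : e * (ρ + ρ ^ 2) ≤ 3 * p + e * y + 2 * (e * y ^ 2) := by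
        have := mul_le_mul_of_nonneg_left h4 he.le
        have e2 := he1 s
        have : e * (2 ^ s * p) = p := by rw [← mul_assoc, e2, one_mul]
        rw [mul_add, hρ] at *
        nlinarith
      have h6 : e * y ^ 2 * 2 ≤ R * (e * y) := by nlinarith [mul_nonneg he.le hy]
      have h7 : 0 ≤ 3 * p + e * y := by positivity
      refine h3.trans ?_
      calc 4 * e * (2 * (16 * n * (ρ + ρ ^ 2))) = 128 * n * (e * (ρ + ρ ^ 2)) := by ring
        _ ≤ 128 * n * (2 * (R * (3 * p + e * y))) := by
            refine mul_le_mul_of_nonneg_left ?_ (by positivity)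
            nlinarith [mul_nonneg he.le hy]
        _ ≤ _ := by nlinarith [mul_nonneg hn (mul_nonneg (by linarith : 0 ≤ R) h7)]
    · have hep : e ≤ p := by
        have e2 := he1 s
        nlinarith
      have hH : ‖Φ (A (s + 1) + A s)‖ ≤ 16 * √n * R := by
        rw [map_add]
        exact (norm_add_le _ _).trans
          (by linarith [hΦA (s + 1) (by omega), hΦA s (by omega)])
      have hG : ‖Φ (A (s + 1) - A s)‖ ≤ 8 * √n * (2 * p + e * y) :=
        (hΦg s hs).trans (by gcongr; linarith)
      have hH' : ‖Ψ (A (s + 1) + A s)‖ ≤ 2 * √n := by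
        rw [hh s hs, map_smul, norm_smul, Real.norm_of_nonneg (by norm_num)]
        have := hΨ s hs _ (hhB s hs)
        gcongr
      have hG' : ‖Ψ (A (s + 1) - A s)‖ ≤ 2 * p * √n := by
        rw [hg s hs, map_smul, norm_smul, Real.norm_of_nonneg (by positivity)]
        have := hΨ s hs _ (hgB s hs)
        gcongr
      refine (abs_sub _ _).trans ?_
      have i1 := (abs_real_inner_le_norm (Φ (A (s + 1) + A s)) (Φ (A (s + 1) - A s))).trans
        (mul_le_mul hH hG (norm_nonneg _) (by positivity))
      have i2 := (abs_real_inner_le_norm (Ψ (A (s + 1) + A s)) (Ψ (A (s + 1) - A s))).trans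
        (mul_le_mul hH' hG' (norm_nonneg _) (by positivity))
      have j1 : 16 * √n * R * (8 * √n * (2 * p + e * y)) = 128 * n * (R * (2 * p + e * y)) := by
        linear_combination 128 * R * (2 * p + e * y) * hsn
      have j2 : 2 * √n * (2 * p * √n) = 4 * n * p := by linear_combination 4 * p * hsn
      rw [j1] at i1
      rw [j2] at i2
      have k1 : p ≤ R * p := by nlinarith
      have k2 : 0 ≤ R * (e * y) := by positivity
      calc _ ≤ 128 * n * (R * (2 * p + e * y)) + 4 * n * p := add_le_add i1 i2
        _ = n * (256 * (R * p) + 128 * (R * (e * y)) + 4 * p) := by ring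
        _ ≤ n * (780 * (R * p) + 260 * (R * (e * y))) :=
            mul_le_mul_of_nonneg_left (by linarith) hn
        _ = _ := by ring
  have htel : ‖Φ (A (S + 1))‖ ^ 2 - ‖Ψ (A (S + 1))‖ ^ 2 = ∑ s ∈ Finset.range (S + 1),
      ((‖Φ (A (s + 1))‖ ^ 2 - ‖Ψ (A (s + 1))‖ ^ 2) - (‖Φ (A s)‖ ^ 2 - ‖Ψ (A s)‖ ^ 2)) := by
    rw [Finset.sum_range_sub (fun s => ‖Φ (A s)‖ ^ 2 - ‖Ψ (A s)‖ ^ 2), hA]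
    simp
  have hP : 0 ≤ (S + 1) * p := by positivity
  rw [htel]
  calc _ ≤ ∑ s ∈ Finset.range (S + 1), 260 * n * R * (3 * p + (1 / 2) ^ s * y) :=
        (Finset.abs_sum_le_sum_abs _ _).trans (Finset.sum_le_sum fun s hs =>
          hstep s (by have := Finset.mem_range.1 hs; omega))
    _ = 260 * n * R * (3 * ((S + 1) * p) +
          (∑ s ∈ Finset.range (S + 1), (1 / 2 : ℝ) ^ s) * y) := by
        rw [← Finset.mul_sum, Finset.sum_add_distrib, Finset.sum_mul]
        simp
        left
        ring
    _ ≤ 260 * n * R * (3 * ((S + 1) * p) + 2 * y) := by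
        have := sum_geometric_two_le (S + 1)
        gcongr
    _ ≤ 260 * n * R * (3 * ((S + 1) * p + y)) := by gcongr; linarith
    _ ≤ 260 * n * (2 + 2 * ((S + 1) * p + y)) * (3 * ((S + 1) * p + y)) := by
        gcongr
        rw [hR]
        linarith
    _ = _ := by ring

lemma mul_mem_boundedLowRank {d1 d2 : ℕ} {W : Matrix (Fin d1) (Fin d1) ℝ} (hW : Wᵀ * W = 1)
    {I : Finset (Fin d1)} {x : Matrix (Fin d1) (Fin d2) ℝ} (hI : ∀ a ∉ I, ∀ j, x a j = 0)
    (hx : ∀ j, ∑ a, x a j ^ 2 ≤ 1) : W * x ∈ boundedLowRank d1 d2 I.card := by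
  let f := I.equivFin
  refine ⟨⟨fun i b => W i (f.symm b), fun j b => x (f.symm b) j, fun i b => ?_, fun j b => ?_,
    fun i j => ?_⟩, fun j => ?_⟩
  · rw [← sq_le_one_iff_abs_le_one]
    set a : Fin d1 := (f.symm b : Fin d1)
    have h : ∑ i, W i a ^ 2 = 1 := by
      have := congrFun (congrFun hW a) a
      simpa [Matrix.mul_apply, sq] using this
    rw [← h]
    exact Finset.single_le_sum (f := fun i => W i a ^ 2) (fun i _ => sq_nonneg _)
      (Finset.mem_univ i)
  · rw [← sq_le_one_iff_abs_le_one]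
    exact (Finset.single_le_sum (f := fun a => x a j ^ 2) (fun a _ => sq_nonneg _)
      (Finset.mem_univ _)).trans (hx j)
  · rw [Equiv.sum_comp f.symm (fun a : I => W i a * x a j), Matrix.mul_apply,
      Finset.sum_coe_sort I (fun a => W i a * x a j)]
    exact (Finset.sum_subset (Finset.subset_univ I) fun a _ ha => by simp [hI a ha j]).symm
  · have h := sum_sq_mulVec_of_orthogonal hW (fun a => x a j)
    have e : W *ᵥ (fun a => x a j) = fun i => (W * x) i j := rfl
    rw [e] at h
    exact h.le.trans (hx j)

/-- Nested level sets of a nonnegative summable weight. -/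
lemma exists_nested_indices {d1 r S : ℕ} (hd1 : 0 < d1) (hr : 0 < r) (hS : d1 ≤ 2 ^ S)
    {lam : Fin d1 → ℝ} (hlam : ∀ a, 0 ≤ lam a) (hsum : ∑ a, lam a ≤ 4 * r) :
    ∃ J : ℕ → Finset (Fin d1), J 0 = ∅ ∧ (∀ s, J s ⊆ J (s + 1)) ∧ J (S + 1) = Finset.univ ∧
      (∀ s, 0 < (J (s + 1)).card) ∧ (∀ s, ((J (s + 1)).card : ℝ) ≤ 5 * r * 4 ^ s) ∧
      ∀ s, ∀ a ∉ J (s + 1), lam a ≤ (1 / 4) ^ s := by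
  classical
  let i0 : Fin d1 := ⟨0, hd1⟩
  let K : ℕ → Finset (Fin d1) := fun s =>
    Finset.univ.filter fun a => (1 / 4 : ℝ) ^ s < lam a ∨ S ≤ s ∨ a = i0
  have hr1 : (1 : ℝ) ≤ r := by exact_mod_cast hr
  refine ⟨fun s => Nat.casesOn s ∅ K, rfl, ?_, ?_, ?_, ?_, ?_⟩
  · rintro (_ | s)
    · exact Finset.empty_subset _
    · intro a ha
      simp only [K, Finset.mem_filter, Finset.mem_univ, true_and] at ha ⊢
      rcases ha with h | h | h
      · refine Or.inl (lt_of_le_of_lt ?_ h)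
        exact pow_le_pow_of_le_one (by norm_num) (by norm_num) (Nat.le_succ s)
      · exact Or.inr (Or.inl (by omega))
      · exact Or.inr (Or.inr h)
  · ext a
    simp [K]
  · intro s
    exact Finset.card_pos.2 ⟨i0, by simp [K]⟩
  · intro s
    change ((K s).card : ℝ) ≤ _
    have h4 : (1 : ℝ) ≤ 4 ^ s := one_le_pow₀ (by norm_num)
    rcases le_or_gt S s with hs | hs
    · have h1 : ((K s).card : ℝ) ≤ d1 := by
        exact_mod_cast (Finset.card_le_univ _).trans (by simp)
      have h2 : (d1 : ℝ) ≤ 2 ^ S := by exact_mod_cast hS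
      have h3 : (2 : ℝ) ^ S ≤ 4 ^ s := (pow_le_pow_right₀ (by norm_num) hs).trans
        (pow_le_pow_left₀ (by norm_num) (by norm_num) s)
      nlinarith
    · let T : Finset (Fin d1) := Finset.univ.filter fun a => (1 / 4 : ℝ) ^ s < lam a
      have hsub : K s ⊆ insert i0 T := by
        intro a ha
        simp only [K, T, Finset.mem_filter, Finset.mem_univ, true_and, Finset.mem_insert] at ha ⊢
        rcases ha with h | h | h
        · exact Or.inr h
        · omega
        · exact Or.inl h
      have h1 : ((K s).card : ℝ) ≤ T.card + 1 := by
        exact_mod_cast (Finset.card_le_card hsub).trans (Finset.card_insert_le _ _)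
      have h2 : (T.card : ℝ) * (1 / 4) ^ s ≤ 4 * r := by
        calc (T.card : ℝ) * (1 / 4) ^ s = ∑ _a ∈ T, (1 / 4 : ℝ) ^ s := by simp
          _ ≤ ∑ a ∈ T, lam a := Finset.sum_le_sum fun a ha => (Finset.mem_filter.1 ha).2.le
          _ ≤ ∑ a, lam a := Finset.sum_le_univ_sum_of_nonneg hlam
          _ ≤ _ := hsum
      have h3 : (T.card : ℝ) ≤ 4 * r * 4 ^ s := by
        calc (T.card : ℝ) = T.card * (1 / 4) ^ s * 4 ^ s := by
              rw [mul_assoc, ← mul_pow]; norm_num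
          _ ≤ _ := by gcongr
      nlinarith
  · intro s a ha
    change a ∉ K s at ha
    simp only [K, Finset.mem_filter, Finset.mem_univ, true_and, not_or, not_lt] at ha
    exact ha.1

/-- The vector of measurements `βₖ ⬝ H e_{jₖ}`. -/
def measurement {n d1 d2 : ℕ} (j : Fin n → Fin d2) (β : Fin n → Fin d1 → ℝ) :
    Matrix (Fin d1) (Fin d2) ℝ →ₗ[ℝ] EuclideanSpace ℝ (Fin n) where
  toFun H := WithLp.toLp 2 fun k => ∑ i, β k i * H i (j k)
  map_add' H H' := by
    ext k
    simp [mul_add, Finset.sum_add_distrib]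
  map_smul' c H := by
    ext k
    simp [Finset.mul_sum, mul_left_comm]

/-- The columns `H e_{jₖ}`, stacked in one vector. -/
def stackedColumns {n d1 d2 : ℕ} (j : Fin n → Fin d2) :
    Matrix (Fin d1) (Fin d2) ℝ →ₗ[ℝ] EuclideanSpace ℝ (Fin n × Fin d1) where
  toFun H := WithLp.toLp 2 fun q => H q.2 (j q.1)
  map_add' H H' := by
    ext q
    simp
  map_smul' c H := by
    ext q
    simp

lemma norm_sq_stackedColumns {n d1 d2 : ℕ} (j : Fin n → Fin d2) (H : Matrix (Fin d1) (Fin d2) ℝ) :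
    ‖stackedColumns j H‖ ^ 2 = ∑ k, ∑ i, H i (j k) ^ 2 := by
  rw [EuclideanSpace.norm_sq_eq, Fintype.sum_prod_type]
  simp [stackedColumns]

lemma deviationForm_eq_norm_sq_sub {n d1 d2 : ℕ} (j : Fin n → Fin d2) (β : Fin n → Fin d1 → ℝ)
    (H : Matrix (Fin d1) (Fin d2) ℝ) :
    deviationForm j β H = ‖measurement j β H‖ ^ 2 - ‖stackedColumns j H‖ ^ 2 := by
  rw [norm_sq_stackedColumns, EuclideanSpace.norm_sq_eq, deviationForm, Finset.sum_sub_distrib]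
  simp [measurement]

/-- A uniform bound on bounded low-rank matrices extends to the unit ball of `tripleNorm`. -/
lemma abs_deviationForm_le_of_tripleNorm_le {n d1 d2 r S : ℕ} (hd1 : 0 < d1) (hr : 0 < r)
    (hS : d1 ≤ 2 ^ S) (j : Fin n → Fin d2) (β : Fin n → Fin d1 → ℝ) {p y : ℝ} (hp : 0 ≤ p)
    (hy : 0 ≤ y)
    (hβ : ∀ k, 0 < k → k ≤ d1 → ∀ s : ℕ, (k : ℝ) ≤ 5 * r * 4 ^ s →
      ∀ H ∈ boundedLowRank d1 d2 k,
      |deviationForm j β H| ≤ 16 * n * ((2 ^ s * p + y) + (2 ^ s * p + y) ^ 2))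
    {M : Matrix (Fin d1) (Fin d2) ℝ} (hM : tripleNorm r M ≤ 1) :
    |deviationForm j β M| ≤ 1560 * n * (((S + 1) * p + y) + ((S + 1) * p + y) ^ 2) := by
  classical
  obtain ⟨W, x, lam, hW, hMx, hlam, hsum, hx, htail⟩ := exists_spectral_coordinates hr hM
  obtain ⟨J, hJ0, hJmono, hJuniv, hJpos, hJcard, hJlam⟩ :=
    exists_nested_indices hd1 hr hS hlam hsum
  let X : ℕ → Matrix (Fin d1) (Fin d2) ℝ := fun s =>
    Matrix.of fun a b => if a ∈ J s then x a b else 0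
  have hX : ∀ s a b, X s a b = if a ∈ J s then x a b else 0 := fun _ _ _ => rfl
  let V : ℕ → Set (Matrix (Fin d1) (Fin d2) ℝ) := fun s =>
    {u | (∀ a ∉ J (s + 1), ∀ b, u a b = 0) ∧ ∀ b, ∑ a, u a b ^ 2 ≤ 1}
  have hmid : ∀ s, ∀ u ∈ V s, ∀ v ∈ V s, (1 / 2 : ℝ) • (u + v) ∈ V s := by
    intro s u hu v hv
    refine ⟨fun a ha b => by simp [hu.1 a ha b, hv.1 a ha b], fun b => ?_⟩
    calc ∑ a, ((1 / 2 : ℝ) • (u + v)) a b ^ 2 ≤ ∑ a, (1 / 2 * u a b ^ 2 + 1 / 2 * v a b ^ 2) := by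
          refine Finset.sum_le_sum fun a _ => ?_
          simp only [Matrix.smul_apply, Matrix.add_apply, smul_eq_mul]
          nlinarith [sq_nonneg (u a b - v a b)]
      _ = 1 / 2 * ∑ a, u a b ^ 2 + 1 / 2 * ∑ a, v a b ^ 2 := by
          rw [Finset.sum_add_distrib, Finset.mul_sum, Finset.mul_sum]
      _ ≤ 1 := by linarith [hu.2 b, hv.2 b]
  have hneg : ∀ s, ∀ u ∈ V s, -u ∈ V s := fun s u hu =>
    ⟨fun a ha b => by simp [hu.1 a ha b], fun b => by simpa using hu.2 b⟩
  have htail' : ∀ s b, ∑ a ∈ (J s)ᶜ, x a b ^ 2 ≤ (2 * (1 / 2) ^ s) ^ 2 := by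
    rintro (_ | s) b
    · rw [hJ0]
      simp only [Finset.compl_empty]
      linarith [hx b]
    · refine (htail _ _ (by positivity) (hJlam s) b).trans (le_of_eq ?_)
      rw [mul_pow, ← pow_mul, mul_comm (s + 1) 2, pow_mul, pow_succ]
      norm_num
      ring
  have hincr : ∀ s, (2 * (1 / 2 : ℝ) ^ s)⁻¹ • (X (s + 1) - X s) ∈ V s := by
    intro s
    refine ⟨fun a ha b => ?_, fun b => ?_⟩
    · have ha' : a ∉ J s := fun h => ha (hJmono s h)
      simp [hX, ha, ha']
    · have h1 : ∑ a, (X (s + 1) a b - X s a b) ^ 2 ≤ (2 * (1 / 2) ^ s) ^ 2 := by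
        refine le_trans ?_ (htail' s b)
        rw [← Finset.sum_subset (Finset.subset_univ (J s)ᶜ)]
        · refine Finset.sum_le_sum fun a ha => ?_
          have ha' : a ∉ J s := by simpa using ha
          simp only [hX, ha', if_false]
          split_ifs
          · simp
          · simpa using sq_nonneg (x a b)
        · intro a _ ha
          have ha' : a ∈ J s := by simpa using ha
          simp [hX, ha', hJmono s ha']
      have hc : (0 : ℝ) < 2 * (1 / 2) ^ s := by positivity
      simp only [Matrix.smul_apply, Matrix.sub_apply, smul_eq_mul, mul_pow, ← Finset.mul_sum]
      rw [inv_pow, inv_mul_le_one₀ (by positivity)]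
      exact h1
  have hav : ∀ s, (1 / 2 : ℝ) • (X (s + 1) + X s) ∈ V s := by
    intro s
    refine ⟨fun a ha b => ?_, fun b => ?_⟩
    · have ha' : a ∉ J s := fun h => ha (hJmono s h)
      simp [hX, ha, ha']
    · refine le_trans (Finset.sum_le_sum fun a _ => ?_) (hx b)
      simp only [hX, Matrix.smul_apply, Matrix.add_apply, smul_eq_mul]
      split_ifs <;> nlinarith [sq_nonneg (x a b)]
  have hB : ∀ s, ∀ F ∈ (W * ·) '' V s, F ∈ boundedLowRank d1 d2 (J (s + 1)).card := by
    rintro s _ ⟨u, hu, rfl⟩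
    exact mul_mem_boundedLowRank hW hu.1 hu.2
  have hXM : W * X (S + 1) = M := by
    rw [hMx]
    congr 1
    ext a b
    simp [hX, hJuniv]
  rw [← hXM, deviationForm_eq_norm_sq_sub]
  refine abs_deviation_chain_le (measurement j β) (stackedColumns j) (fun s => W * X s) ?_ S
    (fun s => (W * ·) '' V s) (Nat.cast_nonneg n) hp hy ?_ ?_ ?_
  · have : X 0 = 0 := by
      ext a b
      simp [hX, hJ0]
    simp [this]
  · intro s _ F hF
    refine Real.le_sqrt_of_sq_le ?_
    rw [norm_sq_stackedColumns]
    calc ∑ k, ∑ i, F i (j k) ^ 2 ≤ ∑ _k : Fin n, (1 : ℝ) :=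
          Finset.sum_le_sum fun k _ => (hB s F hF).2 (j k)
      _ = n := by simp
  · intro s _ F hF
    rw [← deviationForm_eq_norm_sq_sub]
    exact hβ _ (hJpos s) ((Finset.card_le_univ _).trans (by simp)) s (hJcard s) F (hB s F hF)
  · intro s _
    have hc : (2 * (1 / 2 : ℝ) ^ s) ≠ 0 := by positivity
    refine ⟨W * ((2 * (1 / 2 : ℝ) ^ s)⁻¹ • (X (s + 1) - X s)),
      W * ((1 / 2 : ℝ) • (X (s + 1) + X s)), ?_, ?_, ⟨_, hincr s, rfl⟩, ⟨_, hav s, rfl⟩,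
      ⟨_, hmid s _ (hav s) _ (hincr s), ?_⟩, ⟨_, hmid s _ (hav s) _ (hneg s _ (hincr s)), ?_⟩⟩
    · rw [← Matrix.mul_smul, smul_inv_smul₀ hc, Matrix.mul_sub]
    · rw [← Matrix.mul_smul, smul_smul, Matrix.mul_smul, Matrix.mul_add]
      norm_num
    · simp only [Matrix.mul_smul, Matrix.mul_add]
    · simp only [Matrix.mul_smul, Matrix.mul_add, Matrix.mul_neg, sub_eq_add_neg]

lemma sum_comp_mod {L d2 : ℕ} (j : Fin (L * d2) → Fin d2)
    (hj : ∀ k : Fin (L * d2), (j k : ℕ) = (k : ℕ) % d2) (f : Fin d2 → ℝ) :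
    ∑ k, f (j k) = L * ∑ b, f b := by
  rw [← Equiv.sum_comp finProdFinEquiv, Fintype.sum_prod_type]
  have h : ∀ (l : Fin L) (b : Fin d2), j (finProdFinEquiv (l, b)) = b := by
    intro l b
    apply Fin.ext
    rw [hj]
    simp [Nat.mod_eq_of_lt b.2]
  simp [h]

lemma frobNorm_sq_sub_eq {d1 d2 L : ℕ} (hL : 0 < L) (j : Fin (L * d2) → Fin d2)
    (hj : ∀ k : Fin (L * d2), (j k : ℕ) = (k : ℕ) % d2) (β : Fin (L * d2) → Fin d1 → ℝ)
    (M : Matrix (Fin d1) (Fin d2) ℝ) :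
    frobNorm M ^ 2 - (1 / (L : ℝ)) * ∑ k, (∑ i, β k i * M i (j k)) ^ 2 =
      -(1 / (L : ℝ) * deviationForm j β M) := by
  have hL' : (L : ℝ) ≠ 0 := by positivity
  rw [deviationForm, Finset.sum_sub_distrib, sum_comp_mod j hj (fun b => ∑ i, M i b ^ 2),
    frobNorm_sq, Finset.sum_comm]
  field_simp
  ring

lemma clog_add_one_le {N : ℕ} (hN : 2 ≤ N) : (Nat.clog 2 N : ℝ) + 1 ≤ 5 * Real.log N := by
  have hN' : (2 : ℝ) ≤ N := by exact_mod_cast hN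
  have h1 : (2 : ℝ) ^ (Nat.clog 2 N - 1) < N := by
    exact_mod_cast Nat.pow_pred_clog_lt_self (by norm_num) (by omega)
  have hpos : 0 < Nat.clog 2 N := Nat.clog_pos (by norm_num) hN
  have h2 := Real.log_lt_log (by positivity) h1
  rw [Real.log_pow, Nat.cast_sub hpos] at h2
  have h3 := Real.log_two_gt_d9
  have h4 := Real.log_le_log (by norm_num) hN'
  have h5 : (1 : ℝ) ≤ Nat.clog 2 N := by exact_mod_cast hpos
  push_cast at h2
  nlinarith

lemma chaining_level_le {p y τ m : ℝ} (hp : 0 ≤ p) (hy : 0 ≤ y) (hm : 0 ≤ m)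
    (hτ : τ ≤ (m * p) ^ 2 + y ^ 2) : max τ (√τ) ≤ (m * p + y) + (m * p + y) ^ 2 := by
  have hρ : 0 ≤ m * p + y := by positivity
  have h1 : τ ≤ (m * p + y) ^ 2 := by nlinarith [mul_nonneg (mul_nonneg hm hp) hy]
  have h2 : √τ ≤ m * p + y := Real.sqrt_le_iff.2 ⟨hρ, h1⟩
  exact max_le (by linarith) (by nlinarith)

theorem stmt_14 :
    ∃ C : ℝ, 0 < C ∧
    ∀ (d1 d2 L r : ℕ), 0 < d1 → 0 < d2 → 0 < L → 0 < r →
    ∀ (j : Fin (L * d2) → Fin d2), (∀ k : Fin (L * d2), (j k : ℕ) = (k : ℕ) % d2) →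
    ∀ (Ω : Type) (_ : MeasureSpace Ω) (_ : IsProbabilityMeasure (ℙ : Measure Ω))
      (b : Fin (L * d2) → Ω → (Fin d1 → ℝ)),
    -- (b_k) i.i.d. N(0, I_{d1})
    Measure.map (fun ω k => b k ω) ℙ
      = Measure.pi (fun _ : Fin (L * d2) => Measure.pi (fun _ : Fin d1 => gaussianReal 0 1)) →
    ∀ ζ : ℝ, ζ ∈ Set.Ioo (0:ℝ) 1 →
    (1 : ℝ≥0∞) - ENNReal.ofReal ζ ≤
      ℙ {ω : Ω | ∀ M : Matrix (Fin d1) (Fin d2) ℝ, tripleNorm r M ≤ 1 →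
        |(frobNorm M)^2
            - (1 / (L:ℝ)) * ∑ k : Fin (L * d2), (∑ i, b k ω i * M i (j k))^2|
          ≤ C * d2 * max ((max ((r:ℝ) * (d1 + d2) * (Real.log (d1 + d2))^3) (Real.log (2/ζ)))
                / (L * d2))
              (Real.sqrt ((max ((r:ℝ) * (d1 + d2) * (Real.log (d1 + d2))^3) (Real.log (2/ζ)))
                / (L * d2)))} := by
  refine ⟨2558400, by norm_num, ?_⟩
  intro d1 d2 L r hd1 hd2 hL hr j hj Ω _ _ b hb ζ hζ
  have hn : 0 < L * d2 := Nat.mul_pos hL hd2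
  obtain ⟨Good, hGm, hGp, hG⟩ := exists_uniform_event hd1 hd2 hn j hζ
  have hae : AEMeasurable (fun ω k => b k ω) (ℙ : Measure Ω) := by
    by_contra h
    rw [Measure.map_of_not_aemeasurable h] at hb
    exact IsProbabilityMeasure.ne_zero _ hb.symm
  rw [← hb, Measure.map_apply_of_aemeasurable hae hGm] at hGp
  refine hGp.trans (measure_mono fun ω hω M hM => ?_)
  set β : Fin (L * d2) → Fin d1 → ℝ := fun k => b k ω
  have hβ : β ∈ Good := hω
  rw [frobNorm_sq_sub_eq hL j hj β M, abs_neg, abs_mul]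
  have hcast : ((L * d2 : ℕ) : ℝ) = L * d2 := by push_cast; ring
  have hLR : (0 : ℝ) < L := by exact_mod_cast hL
  have hdR : (0 : ℝ) < d2 := by exact_mod_cast hd2
  have hN : 2 ≤ d1 + d2 := by omega
  have hclog := clog_add_one_le hN
  set S := Nat.clog 2 (d1 + d2)
  have hS : d1 ≤ 2 ^ S := (Nat.le_add_right d1 d2).trans (Nat.le_pow_clog (by norm_num) _)
  rw [Nat.cast_add] at hclog
  have hNR : (0 : ℝ) < (d1 : ℝ) + d2 := by positivity
  set N : ℝ := (d1 : ℝ) + d2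
  set Λ := Real.log N
  have hΛ : 0 ≤ Λ := by linarith [(Nat.cast_nonneg S : (0 : ℝ) ≤ S)]
  set z := Real.log (2 / ζ)
  have hz : 0 ≤ z := Real.log_nonneg (by rw [le_div_iff₀ hζ.1]; linarith [hζ.2])
  set n : ℝ := (L : ℝ) * d2 with hn_def
  have hnR : 0 < n := by positivity
  set t := max ((r : ℝ) * N * Λ ^ 3) z / n
  have hrR : (0 : ℝ) < r := by exact_mod_cast hr
  have ht0 : 0 ≤ t := div_nonneg (le_max_of_le_right hz) hnR.le
  have hp2 : √(60 * r * N * Λ / n) ^ 2 = 60 * r * N * Λ / n := Real.sq_sqrt (by positivity)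
  have hy2 : √(z / n) ^ 2 = z / n := Real.sq_sqrt (by positivity)
  have hp : 0 ≤ √(60 * r * N * Λ / n) := Real.sqrt_nonneg _
  have hy : 0 ≤ √(z / n) := Real.sqrt_nonneg _
  set p := √(60 * r * N * Λ / n)
  set y := √(z / n)
  have hdev : |deviationForm j β M| ≤
      1560 * n * (((S + 1) * p + y) + ((S + 1) * p + y) ^ 2) := by
    rw [← hcast]
    refine abs_deviationForm_le_of_tripleNorm_le hd1 hr hS j β hp hy ?_ hM
    intro k hk0 hkd s hks H hH
    refine (hG β hβ k hk0 hkd H hH _ rfl).trans ?_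
    rw [hcast]
    refine mul_le_mul_of_nonneg_left (chaining_level_le hp hy (by positivity) ?_) (by positivity)
    rw [mul_pow, hp2, hy2, ← pow_mul, mul_comm s 2, pow_mul, ← mul_div_assoc, ← add_div]
    refine div_le_div_of_nonneg_right ?_ hnR.le
    have := mul_le_mul_of_nonneg_right hks (by positivity : 0 ≤ 12 * (N * Λ))
    norm_num
    linarith
  have hst : √t ^ 2 = t := Real.sq_sqrt ht0
  have hst0 : 0 ≤ √t := Real.sqrt_nonneg t
  have hyt : y ≤ √t := Real.sqrt_le_sqrt (div_le_div_of_nonneg_right (le_max_right _ _) hnR.le)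
  have hPt : (S + 1) * p ≤ 39 * √t := by
    refine (sq_le_sq₀ (by positivity) (by positivity)).1 ?_
    have h1 : ((S : ℝ) + 1) ^ 2 ≤ (5 * Λ) ^ 2 := pow_le_pow_left₀ (by positivity) hclog 2
    have h2 : r * N * Λ ^ 3 / n ≤ t := div_le_div_of_nonneg_right (le_max_left _ _) hnR.le
    rw [mul_pow, mul_pow, hst, hp2]
    calc ((S : ℝ) + 1) ^ 2 * (60 * r * N * Λ / n) ≤ (5 * Λ) ^ 2 * (60 * r * N * Λ / n) := by
          gcongr
      _ = 1500 * (r * N * Λ ^ 3 / n) := by ring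
      _ ≤ 39 ^ 2 * t := by linarith
  have hv : (S + 1) * p + y ≤ 40 * √t := by linarith
  have hfin : ((S + 1) * p + y) + ((S + 1) * p + y) ^ 2 ≤ 1640 * max t (√t) := by
    have h1 : ((S + 1) * p + y) ^ 2 ≤ (40 * √t) ^ 2 := pow_le_pow_left₀ (by positivity) hv 2
    rw [mul_pow, hst] at h1
    linarith [le_max_left t (√t), le_max_right t (√t)]
  rw [abs_of_pos (by positivity)]
  calc 1 / (L : ℝ) * |deviationForm j β M|
      ≤ 1 / (L : ℝ) * (1560 * n * (1640 * max t (√t))) := by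
        refine mul_le_mul_of_nonneg_left (hdev.trans ?_) (by positivity)
        exact mul_le_mul_of_nonneg_left hfin (by positivity)
    _ = 2558400 * d2 * max t (√t) := by
        rw [hn_def]
        field_simp
        ring
end
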